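/- Let Λ be the d-dimensional hypercubic lattice (d ≥ 3) with side lengths L_1,…,L_d and periodic boundary conditions, with SU(2) lattice gauge theory defined by the Wilson action: Z_Λ = ∫ ∏_b dU_b exp((β/2) Σ_p Tr U_p), where dU is the normalized Haar measure on SU(2) and U_p is the plaquette variable. Fix two distinct directions μ, ν and let V be a vortex for (μ,ν), and let Z_Λ^(−) be the twisted partition function in which Tr U_p is replaced by Tr(−U_p) for every plaquette p ⊂ V. Let C be a rectangular loop of side lengths l_μ, l_ν lying in a μ-ν coordinate plane, with enclosed area A_C = l_μ l_ν, and suppose L_μ = 2^p l_μ and L_ν = 2^q l_ν for some positive integers p, q. Then the expectation of the fundamental Wilson loop W(C) = (1/2) Tr ∏_{b∈C} U_b satisfies ⟨W(C)⟩ ≤ 2 { (1/2)(1 − Z_Λ^(−)/Z_Λ) }^{A_C/(L_μ L_ν)}. -/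

import Mathlib

/-!
Setup: SU(N) lattice gauge theory on a periodic d-dimensional hypercubic lattice.
Sites are `(i : Fin d) → ZMod (L i)`; a configuration assigns an element of `SU N`
to each link `(x, μ)`.  `Pm` is the product of the normalized Haar measure `μH`
(hypothesized as a left-invariant probability measure) over all links, and the
Gibbs weight is `exp ((β/N) Σ_p Re Tr U_p)`.  A vortex for directions `μ < ν` is
specified by coordinates `c1 : ZMod (L μ)`, `c2 : ZMod (L ν)`; `Ovort` is the
vortex creation operator, `Fop` the electric-flux operator, `Ztw` the twisted
partition function, and `rectHol` the holonomy around a rectangular loop.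
-/

open MeasureTheory

namespace TYLGT

noncomputable instance (n : ℕ) : MeasurableSpace (Matrix (Fin n) (Fin n) ℂ) :=
  inferInstanceAs (MeasurableSpace (Fin n → Fin n → ℂ))

/-- The special unitary group `SU(N)` as a subgroup of the unitary group of
`N × N` complex matrices. -/
def SU (N : ℕ) : Subgroup (Matrix.unitaryGroup (Fin N) ℂ) where
  carrier := {A | (A : Matrix (Fin N) (Fin N) ℂ).det = 1}
  mul_mem' := by
    intro a b ha hb
    simp only [Set.mem_setOf_eq, Matrix.UnitaryGroup.mul_val, Matrix.det_mul] at *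
    rw [ha, hb, mul_one]
  one_mem' := by simp
  inv_mem' := by
    intro a ha
    simp only [Set.mem_setOf_eq] at *
    rw [Matrix.UnitaryGroup.inv_val, Matrix.star_eq_conjTranspose, Matrix.det_conjTranspose, ha,
      star_one]

/-- The underlying matrix of an element of `SU(N)`. -/
def toM {N : ℕ} (U : SU N) : Matrix (Fin N) (Fin N) ℂ :=
  ((U : Matrix.unitaryGroup (Fin N) ℂ) : Matrix (Fin N) (Fin N) ℂ)

/-- `z = exp(2πi/N)`, the generator of the center `Z_N ⊆ SU(N)`. -/
noncomputable def zc (N : ℕ) : ℂ := Complex.exp (2 * Real.pi * Complex.I / N)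

variable {d N : ℕ}

/-- Sites of the periodic hypercubic lattice with side lengths `L i`. -/
abbrev Site (L : Fin d → ℕ) := (i : Fin d) → ZMod (L i)

/-- A lattice gauge field configuration: one `SU(N)` element per link `(x, μ)`. -/
abbrev Config (L : Fin d → ℕ) (N : ℕ) := (Site L × Fin d) → SU N

/-- The unit lattice vector in direction `μ`. -/
def e (L : Fin d → ℕ) (μ : Fin d) : Site L := fun i => if i = μ then 1 else 0

/-- The plaquette variable `U_p = U_{x,μ} U_{x+μ̂,ν} U_{x+ν̂,μ}⁻¹ U_{x,ν}⁻¹`. -/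
noncomputable def plaqSU (L : Fin d → ℕ) (U : Config L N) (x : Site L) (μ ν : Fin d) : SU N :=
  U (x, μ) * U (x + e L μ, ν) * (U (x + e L ν, μ))⁻¹ * (U (x, ν))⁻¹

/-- The Wilson action `(β/N) Σ_x Σ_{μ<ν} Re Tr U_p`. -/
noncomputable def S0 (L : Fin d → ℕ) [∀ i, NeZero (L i)] (β : ℝ) (U : Config L N) : ℝ :=
  β / N * ∑ x : Site L, ∑ μ : Fin d, ∑ ν : Fin d,
    if μ < ν then ((toM (plaqSU L U x μ ν)).trace).re else 0

/-- The Gibbs weight `exp(S0)`. -/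
noncomputable def wt (L : Fin d → ℕ) [∀ i, NeZero (L i)] (β : ℝ) (U : Config L N) : ℝ :=
  Real.exp (S0 L β U)

/-- The product over all links of the single-link measure `μH`. -/
noncomputable def Pm (L : Fin d → ℕ) [∀ i, NeZero (L i)] (μH : Measure (SU N))
    [IsProbabilityMeasure μH] : Measure (Config L N) :=
  Measure.pi fun _ => μH

/-- The partition function `Z_Λ`. -/
noncomputable def Zpart (L : Fin d → ℕ) [∀ i, NeZero (L i)] (μH : Measure (SU N))
    [IsProbabilityMeasure μH] (β : ℝ) : ℝ :=
  ∫ U, wt L β U ∂(Pm L μH)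

/-- Expectation value of a complex observable. -/
noncomputable def expecC (L : Fin d → ℕ) [∀ i, NeZero (L i)] (μH : Measure (SU N))
    [IsProbabilityMeasure μH] (β : ℝ) (f : Config L N → ℂ) : ℂ :=
  (∫ U, f U * (wt L β U : ℂ) ∂(Pm L μH)) / (Zpart L μH β : ℂ)

/-- Expectation value of a real observable. -/
noncomputable def expecR (L : Fin d → ℕ) [∀ i, NeZero (L i)] (μH : Measure (SU N))
    [IsProbabilityMeasure μH] (β : ℝ) (f : Config L N → ℝ) : ℝ :=
  (∫ U, f U * wt L β U ∂(Pm L μH)) / Zpart L μH β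

/-- The ordered product of link variables along a straight path of `l` links starting
at `x` in direction `μ`. -/
noncomputable def pathProd (L : Fin d → ℕ) (U : Config L N) (x : Site L) (μ : Fin d) (l : ℕ) :
    SU N :=
  ((List.range l).map fun j => U (x + j • e L μ, μ)).prod

/-- The holonomy around the rectangular loop with corner `x`, sides `lμ`, `lν` in the
`μ`-`ν` coordinate plane. -/
noncomputable def rectHol (L : Fin d → ℕ) (U : Config L N) (x : Site L) (μ ν : Fin d)
    (lμ lν : ℕ) : SU N :=
  pathProd L U x μ lμ * pathProd L U (x + lμ • e L μ) ν lν *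
    (pathProd L U (x + lν • e L ν) μ lμ)⁻¹ * (pathProd L U x ν lν)⁻¹

/-- The vortex creation operator `O^[k][V]` for the vortex with μν-orientation and
coordinates `(c1, c2)`:
`exp((β/N) Σ_{p ⊂ V} [Re Tr(z^k U_p) − Re Tr U_p])`. -/
noncomputable def Ovort (L : Fin d → ℕ) [∀ i, NeZero (L i)] (β : ℝ) {μ ν : Fin d}
    (c1 : ZMod (L μ)) (c2 : ZMod (L ν)) (k : ℕ) (U : Config L N) : ℝ :=
  Real.exp (β / N * ∑ x : Site L,
    if x μ = c1 ∧ x ν = c2 then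
      (zc N ^ k * (toM (plaqSU L U x μ ν)).trace).re - ((toM (plaqSU L U x μ ν)).trace).re
    else 0)

/-- The electric flux creation operator `F^[m][V] = (1/N) Σ_k z^{mk} O^[k][V]`. -/
noncomputable def Fop (L : Fin d → ℕ) [∀ i, NeZero (L i)] (β : ℝ) {μ ν : Fin d}
    (c1 : ZMod (L μ)) (c2 : ZMod (L ν)) (m : ℕ) (U : Config L N) : ℂ :=
  (N : ℂ)⁻¹ * ∑ k ∈ Finset.range N, zc N ^ (m * k) * (Ovort L β c1 c2 k U : ℂ)

/-- The twisted partition function `Z_Λ^[k] = Z_Λ ⟨O^[k][V]⟩`. -/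
noncomputable def Ztw (L : Fin d → ℕ) [∀ i, NeZero (L i)] (μH : Measure (SU N))
    [IsProbabilityMeasure μH] (β : ℝ) {μ ν : Fin d} (c1 : ZMod (L μ)) (c2 : ZMod (L ν))
    (k : ℕ) : ℝ :=
  ∫ U, Ovort L β c1 c2 k U * wt L β U ∂(Pm L μH)

end TYLGT

namespace TYLGT

/-! ### Bounded measurable functions -/

/-- A real function which is measurable and bounded. -/
def BddMeas {Ω : Type*} [MeasurableSpace Ω] (f : Ω → ℝ) : Prop :=
  Measurable f ∧ ∃ C, ∀ u, |f u| ≤ C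

section BddMeas

variable {Ω Ω' : Type*} [MeasurableSpace Ω] [MeasurableSpace Ω'] {f g : Ω → ℝ}

lemma BddMeas.integrable (hf : BddMeas f) (m : Measure Ω) [IsFiniteMeasure m] :
    Integrable f m := by
  obtain ⟨h, C, hC⟩ := hf
  exact Integrable.of_bound h.aestronglyMeasurable C (Filter.Eventually.of_forall hC)

lemma bddMeas_const (c : ℝ) : BddMeas (fun _ : Ω => c) :=
  ⟨measurable_const, |c|, fun _ => le_rfl⟩

lemma BddMeas.add (hf : BddMeas f) (hg : BddMeas g) : BddMeas fun u => f u + g u := by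
  obtain ⟨h, C, hC⟩ := hf
  obtain ⟨h', C', hC'⟩ := hg
  exact ⟨h.add h', C + C', fun u => (abs_add_le _ _).trans (add_le_add (hC u) (hC' u))⟩

lemma BddMeas.mul (hf : BddMeas f) (hg : BddMeas g) : BddMeas fun u => f u * g u := by
  obtain ⟨h, C, hC⟩ := hf
  obtain ⟨h', C', hC'⟩ := hg
  refine ⟨h.mul h', C * C', fun u => ?_⟩
  rw [abs_mul]
  exact mul_le_mul (hC u) (hC' u) (abs_nonneg _) ((abs_nonneg _).trans (hC u))

lemma BddMeas.const_mul (c : ℝ) (hf : BddMeas f) : BddMeas fun u => c * f u :=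
  (bddMeas_const c).mul hf

lemma BddMeas.neg (hf : BddMeas f) : BddMeas fun u => - f u := by
  simpa using hf.const_mul (-1)

lemma BddMeas.sub (hf : BddMeas f) (hg : BddMeas g) : BddMeas fun u => f u - g u := by
  simpa [sub_eq_add_neg] using hf.add hg.neg

lemma BddMeas.pow (hf : BddMeas f) (n : ℕ) : BddMeas fun u => f u ^ n := by
  induction n with
  | zero => simpa using bddMeas_const 1
  | succ n ih => simpa [pow_succ] using ih.mul hf

lemma BddMeas.exp (hf : BddMeas f) : BddMeas fun u => Real.exp (f u) := by
  obtain ⟨h, C, hC⟩ := hf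
  refine ⟨h.exp, Real.exp C, fun u => ?_⟩
  rw [abs_of_pos (Real.exp_pos _)]
  exact Real.exp_le_exp.2 ((le_abs_self _).trans (hC u))

lemma BddMeas.sum {κ : Type*} (s : Finset κ) {F : κ → Ω → ℝ} (hF : ∀ k ∈ s, BddMeas (F k)) :
    BddMeas fun u => ∑ k ∈ s, F k u := by
  classical
  induction s using Finset.induction_on with
  | empty => simpa using bddMeas_const 0
  | insert a s ha ih =>
    simp only [Finset.sum_insert ha]
    exact (hF a (by simp)).add (ih fun k hk => hF k (by simp [hk]))

lemma BddMeas.ite (p : Prop) [Decidable p] (hf : BddMeas f) (hg : BddMeas g) :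
    BddMeas fun u => if p then f u else g u := by
  split_ifs <;> assumption

lemma BddMeas.comp (hf : BddMeas f) {T : Ω' → Ω} (hT : Measurable T) :
    BddMeas fun u => f (T u) := by
  obtain ⟨h, C, hC⟩ := hf
  exact ⟨h.comp hT, C, fun u => hC _⟩

lemma BddMeas.integral_prod_right {h : Ω × Ω' → ℝ} (hh : BddMeas h) (m : Measure Ω')
    [IsProbabilityMeasure m] : BddMeas fun u => ∫ v, h (u, v) ∂m := by
  obtain ⟨hm, C, hC⟩ := hh
  refine ⟨(hm.stronglyMeasurable.integral_prod_right' (ν := m)).measurable, C, fun u => ?_⟩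
  have := norm_integral_le_of_norm_le_const (μ := m) (f := fun v => h (u, v)) (C := C)
    (Filter.Eventually.of_forall fun v => hC (u, v))
  simpa using this

lemma integral_mul_sq_le (m : Measure Ω) [IsFiniteMeasure m] (hf : BddMeas f) (hg : BddMeas g) :
    (∫ u, f u * g u ∂m) ^ 2 ≤ (∫ u, f u ^ 2 ∂m) * ∫ u, g u ^ 2 ∂m := by
  have key : ∀ t : ℝ, 0 ≤ (∫ u, f u ^ 2 ∂m) * (t * t) + (2 * ∫ u, f u * g u ∂m) * t
      + ∫ u, g u ^ 2 ∂m := by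
    intro t
    have h : ∫ u, (t * f u + g u) ^ 2 ∂m = (∫ u, f u ^ 2 ∂m) * (t * t)
        + (2 * ∫ u, f u * g u ∂m) * t + ∫ u, g u ^ 2 ∂m := by
      have e : ∀ u, (t * f u + g u) ^ 2 = (t * t) * f u ^ 2 + (2 * t) * (f u * g u) + g u ^ 2 :=
        fun u => by ring
      simp only [e]
      rw [integral_add _ ((hg.pow 2).integrable m), integral_add, integral_const_mul,
        integral_const_mul]
      · ring
      · exact ((hf.pow 2).const_mul _).integrable m
      · exact ((hf.mul hg).const_mul _).integrable m
      · exact (((hf.pow 2).const_mul (t * t)).add ((hf.mul hg).const_mul (2 * t))).integrable m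
    rw [← h]
    exact integral_nonneg fun u => sq_nonneg _
  have := discrim_le_zero key
  rw [discrim] at this
  nlinarith

end BddMeas

/-! ### Reflection positivity for product measures -/

section Reflection

open Classical in
lemma measurable_piecewise_prod {ι G : Type*} [MeasurableSpace G] (S : Set ι) :
    Measurable fun z : (ι → G) × (ι → G) => S.piecewise z.1 z.2 := by
  refine measurable_pi_lambda _ fun b => ?_
  by_cases h : b ∈ S
  · simp only [Set.piecewise, h, if_true]
    exact (measurable_pi_apply b).comp measurable_fst
  · simp only [Set.piecewise, h, if_false]
    exact (measurable_pi_apply b).comp measurable_snd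

variable {ι G : Type*} [Fintype ι] [MeasurableSpace G]

open Classical in
lemma measurePreserving_piecewise (m : Measure G) [IsProbabilityMeasure m] (S : Set ι) :
    MeasurePreserving (fun z : (ι → G) × (ι → G) => S.piecewise z.1 z.2)
      ((Measure.pi fun _ => m).prod (Measure.pi fun _ => m)) (Measure.pi fun _ => m) := by
  refine ⟨measurable_piecewise_prod S, (Measure.pi_eq fun s hs => ?_).symm⟩
  rw [Measure.map_apply (measurable_piecewise_prod S) (MeasurableSet.univ_pi hs)]
  have : (fun z : (ι → G) × (ι → G) => S.piecewise z.1 z.2) ⁻¹' Set.univ.pi s =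
      (Set.univ.pi fun b => if b ∈ S then s b else Set.univ) ×ˢ
        (Set.univ.pi fun b => if b ∈ S then Set.univ else s b) := by
    ext ⟨u, v⟩
    simp only [Set.mem_preimage, Set.mem_pi, Set.mem_univ, forall_true_left, Set.mem_prod,
      ← forall_and]
    refine forall_congr' fun b => ?_
    by_cases h : b ∈ S <;> simp [Set.piecewise, h]
  rw [this, Measure.prod_prod, Measure.pi_pi, Measure.pi_pi, ← Finset.prod_mul_distrib]
  refine Finset.prod_congr rfl fun b _ => ?_
  by_cases h : b ∈ S <;> simp [h]

open Classical in
lemma integral_piecewise (m : Measure G) [IsProbabilityMeasure m] (S : Set ι)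
    {h : (ι → G) → ℝ} (hh : BddMeas h) :
    ∫ u, h u ∂(Measure.pi fun _ => m) =
      ∫ u, ∫ v, h (S.piecewise u v) ∂(Measure.pi fun _ => m) ∂(Measure.pi fun _ => m) := by
  rw [← (measurePreserving_piecewise m S).map_eq, integral_map
    (measurable_piecewise_prod S).aemeasurable hh.1.aestronglyMeasurable,
    (measurePreserving_piecewise m S).map_eq]
  exact integral_prod _ ((hh.comp (measurable_piecewise_prod S)).integrable _)

/-- A measure preserving map `T` of configurations which fixes the variables in `P` and for which
the remaining variables of `Λ` after applying `T` are functions of the variables outside `Λ`. -/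
structure IsReflection (m : Measure G) [IsProbabilityMeasure m] (Λ P : Set ι)
    (T : (ι → G) → ι → G) : Prop where
  subset : P ⊆ Λ
  measurePreserving : MeasurePreserving T (Measure.pi fun _ => m) (Measure.pi fun _ => m)
  fix : ∀ u, ∀ b ∈ P, T u b = u b
  swap : ∀ b ∈ Λ \ P, DependsOn (fun u => T u b) Λᶜ

variable (m : Measure G)

open Classical in
/-- The conditional expectation of `f` given the variables in `P`. -/
noncomputable def condInt (P : Set ι) (f : (ι → G) → ℝ) (u : ι → G) : ℝ :=
  ∫ v, f (P.piecewise u v) ∂(Measure.pi fun _ => m)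

open Classical in
lemma BddMeas.condInt [IsProbabilityMeasure m] (P : Set ι) {f : (ι → G) → ℝ} (hf : BddMeas f) :
    BddMeas (condInt m P f) :=
  (hf.comp (measurable_piecewise_prod P)).integral_prod_right _

lemma condInt_mul (P : Set ι) {a f : (ι → G) → ℝ} (ha : DependsOn a P) (u : ι → G) :
    condInt m P (fun u => a u * f u) u = a u * condInt m P f u := by
  classical
  rw [condInt, condInt, ← integral_const_mul]
  refine integral_congr_ae (Filter.Eventually.of_forall fun v => ?_)
  have : a (P.piecewise u v) = a u := ha fun b hb => by simp [hb]
  simp [this]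

variable {m} [IsProbabilityMeasure m] {Λ P : Set ι} {T : (ι → G) → ι → G}

lemma IsReflection.integral_mul (hT : IsReflection m Λ P T) {f g : (ι → G) → ℝ}
    (hf : BddMeas f) (hg : BddMeas g) (hfΛ : DependsOn f Λ) (hgΛ : DependsOn g Λ) :
    ∫ u, f u * g (T u) ∂(Measure.pi fun _ => m) =
      ∫ u, condInt m P f u * condInt m P g u ∂(Measure.pi fun _ => m) := by
  classical
  have hgT : BddMeas fun u => g (T u) := hg.comp hT.measurePreserving.measurable
  have hfg : BddMeas fun u => f u * g (T u) := hf.mul hgT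
  rw [integral_piecewise m P hfg]
  refine integral_congr_ae (Filter.Eventually.of_forall fun u => ?_)
  have hmu : Measurable fun v : ι → G => P.piecewise u v :=
    (measurable_piecewise_prod P).comp (measurable_const.prodMk measurable_id)
  beta_reduce
  obtain ⟨Q, hQ⟩ : ∃ Q, Q = Λ \ P := ⟨_, rfl⟩
  have hQ' : ∀ b ∈ Λ, b ∉ P → b ∈ Q := fun b h h' => hQ ▸ ⟨h, h'⟩
  have hQΛ : ∀ b, b ∉ Λ → b ∉ Q := fun b h h' => h (hQ ▸ h' : b ∈ Λ \ P).1
  rw [integral_piecewise m Q (hfg.comp hmu)]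
  have e1 : ∀ v v' : ι → G, f (P.piecewise u (Q.piecewise v v')) = f (P.piecewise u v) := by
    intro v v'
    refine hfΛ fun b hb => ?_
    by_cases h : b ∈ P
    · simp [Set.piecewise, h]
    · simp [Set.piecewise, h, hQ' b hb h]
  have e2 : ∀ v v' : ι → G, g (T (P.piecewise u (Q.piecewise v v'))) =
      g (P.piecewise u (T v')) := by
    intro v v'
    refine hgΛ fun b hb => ?_
    by_cases h : b ∈ P
    · rw [hT.fix _ _ h]
      simp [Set.piecewise, h]
    · rw [Set.piecewise_eq_of_notMem _ _ _ h]
      refine hT.swap b ⟨hb, h⟩ fun c hc => ?_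
      have : c ∉ P := fun h' => hc (hT.subset h')
      simp [Set.piecewise, this, hQΛ c hc]
  simp_rw [e1, e2, integral_const_mul, integral_mul_const]
  congr 1
  rw [condInt]
  have := integral_map (μ := Measure.pi fun _ : ι => m) (φ := T)
    hT.measurePreserving.measurable.aemeasurable
    (f := fun v => g (P.piecewise u v)) (hg.comp hmu).1.aestronglyMeasurable
  rw [hT.measurePreserving.map_eq] at this
  exact this.symm

/-- Cauchy–Schwarz inequality for reflections, with bounded coefficients depending on the
invariant variables. -/
lemma IsReflection.cauchySchwarz (hT : IsReflection m Λ P T) {κ : Type*} [Fintype κ]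
    {a f : κ → (ι → G) → ℝ} {g E : (ι → G) → ℝ}
    (ha : ∀ k, BddMeas (a k)) (haP : ∀ k, DependsOn (a k) P) (ha1 : ∀ u, ∑ k, a k u ^ 2 ≤ 1)
    (hf : ∀ k, BddMeas (f k)) (hfΛ : ∀ k, DependsOn (f k) Λ)
    (hg : BddMeas g) (hgΛ : DependsOn g Λ) (hE : BddMeas E) (hEΛ : DependsOn E Λ) :
    (∫ u, (∑ k, a k u * f k u) * g (T u) * (E u * E (T u)) ∂(Measure.pi fun _ => m)) ^ 2 ≤
      (∫ u, (∑ k, f k u * f k (T u)) * (E u * E (T u)) ∂(Measure.pi fun _ => m)) *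
        ∫ u, g u * g (T u) * (E u * E (T u)) ∂(Measure.pi fun _ => m) := by
  have hPΛ : ∀ k, DependsOn (a k) Λ := fun k u v h => haP k fun b hb => h b (hT.subset hb)
  have hfE : ∀ k, BddMeas fun u => f k u * E u := fun k => (hf k).mul hE
  have hfEΛ : ∀ k, DependsOn (fun u => f k u * E u) Λ := fun k u v h => by
    simp only [hfΛ k h, hEΛ h]
  have hgE : BddMeas fun u => g u * E u := hg.mul hE
  have hgEΛ : DependsOn (fun u => g u * E u) Λ := fun u v h => by
    simp only [hgΛ h, hEΛ h]
  have hmT := hT.measurePreserving.measurable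
  set F : κ → (ι → G) → ℝ := fun k => condInt m P fun u => f k u * E u with hF
  set H : (ι → G) → ℝ := condInt m P fun u => g u * E u with hH
  have hFB : ∀ k, BddMeas (F k) := fun k => (hfE k).condInt m P
  have hHB : BddMeas H := hgE.condInt m P
  have i1 : ∫ u, (∑ k, a k u * f k u) * g (T u) * (E u * E (T u)) ∂(Measure.pi fun _ => m) =
      ∫ u, (∑ k, a k u * F k u) * H u ∂(Measure.pi fun _ => m) := by
    have l : ∀ u, (∑ k, a k u * f k u) * g (T u) * (E u * E (T u)) =
        ∑ k, (a k u * (f k u * E u)) * (g (T u) * E (T u)) := fun u => by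
      rw [Finset.sum_mul, Finset.sum_mul]
      exact Finset.sum_congr rfl fun k _ => by ring
    have r : ∀ u, (∑ k, a k u * F k u) * H u = ∑ k, a k u * F k u * H u := fun u => by
      rw [Finset.sum_mul]
    simp only [l, r]
    rw [integral_finsetSum, integral_finsetSum]
    · refine Finset.sum_congr rfl fun k _ => ?_
      rw [hT.integral_mul (f := fun u => a k u * (f k u * E u)) (g := fun u => g u * E u)
        ((ha k).mul (hfE k)) hgE (fun u v h => by simp only [hPΛ k h, hfΛ k h, hEΛ h]) hgEΛ]
      simp only [condInt_mul m P (haP k), hF, hH]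
    · exact fun k _ => (((ha k).mul (hFB k)).mul hHB).integrable _
    · exact fun k _ => (((ha k).mul (hfE k)).mul (hgE.comp hmT)).integrable _
  have i2 : ∫ u, (∑ k, f k u * f k (T u)) * (E u * E (T u)) ∂(Measure.pi fun _ => m) =
      ∫ u, ∑ k, F k u ^ 2 ∂(Measure.pi fun _ => m) := by
    have l : ∀ u, (∑ k, f k u * f k (T u)) * (E u * E (T u)) =
        ∑ k, (f k u * E u) * (f k (T u) * E (T u)) := fun u => by
      rw [Finset.sum_mul]
      exact Finset.sum_congr rfl fun k _ => by ring
    simp only [l]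
    rw [integral_finsetSum, integral_finsetSum]
    · refine Finset.sum_congr rfl fun k _ => ?_
      rw [hT.integral_mul (f := fun u => f k u * E u) (g := fun u => f k u * E u)
        (hfE k) (hfE k) (hfEΛ k) (hfEΛ k)]
      simp only [hF, sq]
    · exact fun k _ => ((hFB k).pow 2).integrable _
    · exact fun k _ => ((hfE k).mul ((hfE k).comp hmT)).integrable _
  have i3 : ∫ u, g u * g (T u) * (E u * E (T u)) ∂(Measure.pi fun _ => m) =
      ∫ u, H u ^ 2 ∂(Measure.pi fun _ => m) := by
    have l : ∀ u, g u * g (T u) * (E u * E (T u)) = (g u * E u) * (g (T u) * E (T u)) :=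
      fun u => by ring
    simp only [l]
    rw [hT.integral_mul (f := fun u => g u * E u) (g := fun u => g u * E u) hgE hgE hgEΛ hgEΛ]
    simp only [hH, sq]
  rw [i1, i2, i3]
  have haF : BddMeas fun u => ∑ k, a k u * F k u :=
    BddMeas.sum _ fun k _ => (ha k).mul (hFB k)
  refine (integral_mul_sq_le _ haF hHB).trans ?_
  refine mul_le_mul_of_nonneg_right ?_ (integral_nonneg fun u => sq_nonneg _)
  refine integral_mono ((haF.pow 2).integrable _)
    ((BddMeas.sum _ fun k _ => (hFB k).pow 2).integrable _) fun u => ?_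
  refine (Finset.sum_mul_sq_le_sq_mul_sq _ _ _).trans ?_
  exact mul_le_of_le_one_left (Finset.sum_nonneg fun k _ => sq_nonneg _) (ha1 u)

lemma IsReflection.integral_mul_le (hT : IsReflection m Λ P T) {a f E : (ι → G) → ℝ}
    (ha : BddMeas a) (haP : DependsOn a P) (ha1 : ∀ u, a u ≤ 1)
    (hf : BddMeas f) (hfΛ : DependsOn f Λ) (hE : BddMeas E) (hEΛ : DependsOn E Λ) :
    ∫ u, a u * (f u * f (T u)) * (E u * E (T u)) ∂(Measure.pi fun _ => m) ≤
      ∫ u, f u * f (T u) * (E u * E (T u)) ∂(Measure.pi fun _ => m) := by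
  have hPΛ : DependsOn a Λ := fun u v h => haP fun b hb => h b (hT.subset hb)
  have hfE : BddMeas fun u => f u * E u := hf.mul hE
  have hfEΛ : DependsOn (fun u => f u * E u) Λ := fun u v h => by
    simp only [hfΛ h, hEΛ h]
  have l : ∀ u, a u * (f u * f (T u)) * (E u * E (T u)) =
      (a u * (f u * E u)) * (f (T u) * E (T u)) := fun u => by ring
  have l' : ∀ u, f u * f (T u) * (E u * E (T u)) = (f u * E u) * (f (T u) * E (T u)) :=
    fun u => by ring
  simp only [l, l']
  rw [hT.integral_mul (f := fun u => a u * (f u * E u)) (g := fun u => f u * E u)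
      (ha.mul hfE) hfE (fun u v h => by simp only [hPΛ h, hfΛ h, hEΛ h]) hfEΛ,
    hT.integral_mul (f := fun u => f u * E u) (g := fun u => f u * E u) hfE hfE hfEΛ hfEΛ]
  have hc := hfE.condInt m P
  simp only [condInt_mul m P haP]
  refine integral_mono (((ha.mul hc).mul hc).integrable _) ((hc.mul hc).integrable _) fun u => ?_
  simp only
  nlinarith [ha1 u, mul_self_nonneg (condInt m P (fun u => f u * E u) u)]

end Reflection

/-! ### The group `SU(2)` and unit quaternions -/

section SU2

lemma toM_mul {N : ℕ} (g h : SU N) : toM (g * h) = toM g * toM h := rfl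

lemma toM_inv {N : ℕ} (g : SU N) : toM g⁻¹ = star (toM g) := rfl

lemma toM_one {N : ℕ} : toM (1 : SU N) = 1 := rfl

lemma toM_injective {N : ℕ} : Function.Injective (toM (N := N)) :=
  Subtype.val_injective.comp Subtype.val_injective

lemma toM_det {N : ℕ} (g : SU N) : (toM g).det = 1 := g.2

lemma star_toM_eq_adjugate {N : ℕ} (g : SU N) : star (toM g) = (toM g).adjugate := by
  have h1 : star (toM g) * toM g = 1 := (Matrix.mem_unitaryGroup_iff').1 g.1.2
  have h2 : toM g * (toM g).adjugate = 1 := by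
    rw [Matrix.mul_adjugate, toM_det, one_smul]
  calc star (toM g) = star (toM g) * (toM g * (toM g).adjugate) := by rw [h2, mul_one]
    _ = (toM g).adjugate := by rw [← mul_assoc, h1, one_mul]

lemma toM_one_one (g : SU 2) : toM g 1 1 = star (toM g 0 0) := by
  have h := congrFun (congrFun (star_toM_eq_adjugate g) 0) 0
  rw [Matrix.adjugate_fin_two] at h
  simpa [Matrix.star_apply] using h.symm

lemma toM_one_zero (g : SU 2) : toM g 1 0 = - star (toM g 0 1) := by
  have h := congrFun (congrFun (star_toM_eq_adjugate g) 1) 0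
  rw [Matrix.adjugate_fin_two] at h
  simp only [Matrix.star_apply, Matrix.of_apply, Matrix.cons_val_one, Matrix.cons_val_zero] at h
  rw [h]
  simp

/-- The unit quaternion corresponding to an element of `SU(2)`. -/
def quat (g : SU 2) : Quaternion ℝ :=
  ⟨(toM g 0 0).re, (toM g 0 0).im, (toM g 0 1).re, (toM g 0 1).im⟩

lemma quat_re (g : SU 2) : (quat g).re = (toM g 0 0).re := rfl

lemma quat_imI (g : SU 2) : (quat g).imI = (toM g 0 0).im := rfl

lemma quat_imJ (g : SU 2) : (quat g).imJ = (toM g 0 1).re := rfl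

lemma quat_imK (g : SU 2) : (quat g).imK = (toM g 0 1).im := rfl

lemma quat_mul (g h : SU 2) : quat (g * h) = quat g * quat h := by
  apply Quaternion.ext <;> simp only [Quaternion.re_mul, Quaternion.imI_mul, Quaternion.imJ_mul,
    Quaternion.imK_mul, quat_re, quat_imI, quat_imJ, quat_imK] <;>
    simp [toM_mul, Matrix.mul_apply, Fin.sum_univ_two, toM_one_one, toM_one_zero] <;>
    ring

lemma quat_one : quat 1 = 1 := by
  apply Quaternion.ext <;> simp [quat_re, quat_imI, quat_imJ, quat_imK, toM_one] <;> rfl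

lemma quat_inv (g : SU 2) : quat g⁻¹ = star (quat g) := by
  apply Quaternion.ext <;> simp only [Quaternion.re_star, Quaternion.imI_star,
    Quaternion.imJ_star, Quaternion.imK_star, quat_re, quat_imI, quat_imJ, quat_imK] <;>
    simp [toM_inv, Matrix.star_apply, toM_one_zero]

lemma trace_toM_re (g : SU 2) : (toM g).trace.re = 2 * (quat g).re := by
  simp [quat, Matrix.trace_fin_two, toM_one_one]
  ring

lemma quat_mul_star (g : SU 2) : quat g * star (quat g) = 1 := by
  rw [← quat_inv, ← quat_mul, mul_inv_cancel, quat_one]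

lemma quat_sq_add (g : SU 2) :
    (quat g).re ^ 2 + (quat g).imI ^ 2 + (quat g).imJ ^ 2 + (quat g).imK ^ 2 = 1 := by
  have h := congrArg (fun q : Quaternion ℝ => q.re) (quat_mul_star g)
  simp only [Quaternion.re_mul, Quaternion.re_star, Quaternion.imI_star, Quaternion.imJ_star,
    Quaternion.imK_star, Quaternion.re_one] at h
  linarith

/-- The coordinates of the unit quaternion corresponding to an element of `SU(2)`. -/
def qc (g : SU 2) : Fin 4 → ℝ :=
  ![(quat g).re, (quat g).imI, (quat g).imJ, (quat g).imK]

/-- The normalized character `g ↦ (1/2) Tr g` of `SU(2)`. -/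
def chi (g : SU 2) : ℝ := (quat g).re

lemma trace_toM_re_eq (g : SU 2) : (toM g).trace.re = 2 * chi g := trace_toM_re g

lemma trace_toM_eq (g : SU 2) : (toM g).trace = 2 * (chi g : ℂ) := by
  apply Complex.ext
  · rw [trace_toM_re_eq]
    simp
  · simp [Matrix.trace_fin_two, toM_one_one]

lemma sum_qc_sq (g : SU 2) : ∑ k, qc g k ^ 2 = 1 := by
  simp [Fin.sum_univ_four, qc, quat_sq_add]

lemma abs_qc_le (g : SU 2) (k : Fin 4) : |qc g k| ≤ 1 := by
  rw [← sq_le_one_iff_abs_le_one, ← sum_qc_sq g]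
  exact Finset.single_le_sum (f := fun k => qc g k ^ 2) (fun _ _ => sq_nonneg _)
    (Finset.mem_univ k)

lemma abs_chi_le (g : SU 2) : |chi g| ≤ 1 := abs_qc_le g 0

lemma chi_inv (g : SU 2) : chi g⁻¹ = chi g := by simp [chi, quat_inv]

lemma chi_mul_comm (g h : SU 2) : chi (g * h) = chi (h * g) := by
  simp only [chi, quat_mul, Quaternion.re_mul]
  ring

lemma chi_mul_inv (g h : SU 2) : chi (g * h⁻¹) = ∑ k, qc h k * qc g k := by
  simp [chi, quat_mul, quat_inv, Quaternion.re_mul, Fin.sum_univ_four, qc]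
  ring

/-- The basis quaternions. -/
def qbasis : Fin 4 → Quaternion ℝ :=
  ![⟨1, 0, 0, 0⟩, ⟨0, 1, 0, 0⟩, ⟨0, 0, 1, 0⟩, ⟨0, 0, 0, 1⟩]

/-- The matrix coefficients of the bilinear form `(p, q) ↦ Re (p b q b⁻¹)`. -/
noncomputable def conjCoeff (b : SU 2) (k : Fin 4 × Fin 4) : ℝ :=
  (qbasis k.1 * quat b * qbasis k.2 * star (quat b)).re

lemma chi_mul_conj (p q b : SU 2) :
    chi (p * b * q * b⁻¹) = ∑ k : Fin 4 × Fin 4, qc p k.1 * qc q k.2 * conjCoeff b k := by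
  rw [Fintype.sum_prod_type]
  simp [chi, quat_mul, quat_inv, Quaternion.re_mul, Quaternion.imI_mul, Quaternion.imJ_mul,
    Quaternion.imK_mul, Fin.sum_univ_four, qc, conjCoeff, qbasis]
  ring

lemma sum_conjCoeff_mul (b b' : SU 2) :
    ∑ k, conjCoeff b k * conjCoeff b' k = 4 * chi (b * b'⁻¹) ^ 2 := by
  rw [Fintype.sum_prod_type]
  simp [chi, quat_mul, quat_inv, Quaternion.re_mul, Quaternion.imI_mul, Quaternion.imJ_mul,
    Quaternion.imK_mul, Fin.sum_univ_four, conjCoeff, qbasis]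
  ring_nf

lemma zc_two : zc 2 = -1 := by
  rw [zc, ← Complex.exp_pi_mul_I]
  congr 1
  push_cast
  ring

/-- The element `-1` of `SU(2)`. -/
def negOne : SU 2 :=
  ⟨⟨-1, by simp [Matrix.mem_unitaryGroup_iff]⟩, by simp [SU, Matrix.det_fin_two]⟩

lemma toM_negOne : toM negOne = -1 := rfl

lemma quat_negOne : quat negOne = -1 := by
  apply Quaternion.ext <;> simp [quat_re, quat_imI, quat_imJ, quat_imK, toM_negOne] <;> rfl

lemma negOne_mul_comm (g : SU 2) : negOne * g = g * negOne := by
  apply toM_injective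
  simp [toM_mul, toM_negOne]

lemma negOne_inv : negOne⁻¹ = negOne := by
  apply toM_injective
  simp [toM_inv, toM_negOne]

lemma chi_negOne_mul (g : SU 2) : chi (negOne * g) = - chi g := by
  simp [chi, quat_mul, quat_negOne]

/-! Measurability on `SU(2)` -/

lemma measurable_toM_apply {N : ℕ} (i j : Fin N) : Measurable fun g : SU N => toM g i j :=
  have h : Measurable fun g : SU N => toM g :=
    (measurable_subtype_coe (p := fun A : Matrix (Fin N) (Fin N) ℂ =>
      A ∈ Matrix.unitaryGroup (Fin N) ℂ)).comp measurable_subtype_coe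
  (measurable_pi_apply j).comp ((measurable_pi_apply i).comp h)

lemma measurable_of_toM {Ω : Type*} [MeasurableSpace Ω] {N : ℕ} {f : Ω → SU N}
    (h : ∀ i j, Measurable fun u => toM (f u) i j) : Measurable f :=
  Measurable.subtype_mk (Measurable.subtype_mk
    (measurable_pi_lambda _ fun i => measurable_pi_lambda _ fun j => h i j))

instance {N : ℕ} : MeasurableMul₂ (SU N) where
  measurable_mul := by
    refine measurable_of_toM fun i j => ?_
    simp only [toM_mul, Matrix.mul_apply]
    exact Finset.measurable_sum _ fun k _ =>
      ((measurable_toM_apply i k).comp measurable_fst).mul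
        ((measurable_toM_apply k j).comp measurable_snd)

instance {N : ℕ} : MeasurableInv (SU N) where
  measurable_inv := by
    refine measurable_of_toM fun i j => ?_
    simp only [toM_inv, Matrix.star_apply]
    exact Complex.continuous_conj.measurable.comp (measurable_toM_apply j i)

lemma measurable_qc (k : Fin 4) : Measurable fun g => qc g k := by
  have h0 := measurable_toM_apply (N := 2) 0 0
  have h1 := measurable_toM_apply (N := 2) 0 1
  fin_cases k
  · exact Complex.measurable_re.comp h0
  · exact Complex.measurable_im.comp h0
  · exact Complex.measurable_re.comp h1
  · exact Complex.measurable_im.comp h1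

lemma measurable_chi : Measurable chi := measurable_qc 0

lemma bddMeas_qc (k : Fin 4) : BddMeas fun g => qc g k := ⟨measurable_qc k, 1, (abs_qc_le · k)⟩

lemma bddMeas_chi : BddMeas chi := bddMeas_qc 0

lemma bddMeas_conjCoeff (k : Fin 4 × Fin 4) : BddMeas fun b => conjCoeff b k := by
  have h0 : Measurable fun b => (quat b).re := measurable_qc 0
  have h1 : Measurable fun b => (quat b).imI := measurable_qc 1
  have h2 : Measurable fun b => (quat b).imJ := measurable_qc 2
  have h3 : Measurable fun b => (quat b).imK := measurable_qc 3
  refine ⟨?_, 2, fun b => ?_⟩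
  · simp only [conjCoeff, Quaternion.re_mul, Quaternion.imI_mul, Quaternion.imJ_mul,
      Quaternion.imK_mul, Quaternion.re_star, Quaternion.imI_star, Quaternion.imJ_star,
      Quaternion.imK_star]
    fun_prop
  · have h := sum_conjCoeff_mul b b
    have hk := Finset.single_le_sum (f := fun k => conjCoeff b k * conjCoeff b k)
      (fun _ _ => mul_self_nonneg _) (Finset.mem_univ k)
    rw [mul_inv_cancel] at h
    have h1 : chi 1 = 1 := by simp [chi, quat_re, toM_one]
    rw [h, h1] at hk
    exact abs_le_of_sq_le_sq (by linarith) zero_le_two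

/-- A left-invariant probability measure on a measurable group is invariant under inversion. -/
lemma measurePreserving_inv_of_left_invariant {G : Type*} [Group G] [MeasurableSpace G]
    [MeasurableMul₂ G] [MeasurableInv G] (m : Measure G) [IsProbabilityMeasure m]
    (h : ∀ g : G, Measure.map (fun u => g * u) m = m) :
    MeasurePreserving (fun u : G => u⁻¹) m m := by
  have : m.IsMulLeftInvariant := ⟨h⟩
  have h1 := (measurePreserving_fst (μ := m) (ν := m)).map_eq
  have h2 := (measurePreserving_snd.comp (measurePreserving_mul_prod_inv m m)).map_eq
  refine ⟨measurable_inv, ?_⟩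
  nth_rewrite 1 [← h1]
  rw [Measure.map_map measurable_inv measurable_fst]
  exact h2

end SU2

/-! ### Plaquettes and paths -/

section Lattice

lemma measurePreserving_pi_perm {ι G : Type*} [Fintype ι] [MeasurableSpace G] (m : Measure G)
    [IsProbabilityMeasure m] (σ : ι ≃ ι) (φ : ι → G → G) (hφ : ∀ b, MeasurePreserving (φ b) m m) :
    MeasurePreserving (fun (u : ι → G) b => φ b (u (σ b))) (Measure.pi fun _ => m)
      (Measure.pi fun _ => m) := by
  have hm : Measurable fun (u : ι → G) b => φ b (u (σ b)) :=
    measurable_pi_lambda _ fun b => (hφ b).measurable.comp (measurable_pi_apply (σ b))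
  refine ⟨hm, (Measure.pi_eq fun s hs => ?_).symm⟩
  rw [Measure.map_apply hm (MeasurableSet.univ_pi hs)]
  have : (fun (u : ι → G) b => φ b (u (σ b))) ⁻¹' Set.univ.pi s =
      Set.univ.pi fun c => φ (σ.symm c) ⁻¹' s (σ.symm c) := by
    ext u
    simp only [Set.mem_preimage, Set.mem_pi, Set.mem_univ, forall_true_left]
    exact ⟨fun h c => by simpa using h (σ.symm c), fun h b => by simpa using h (σ b)⟩
  rw [this, Measure.pi_pi]
  simp only [(hφ _).measure_preimage (hs _).nullMeasurableSet]
  exact Equiv.prod_comp σ.symm fun b => m (s b)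

variable {d : ℕ} {L : Fin d → ℕ}

lemma e_apply_self (μ : Fin d) : e L μ μ = 1 := by simp [e]

lemma e_apply_ne {μ i : Fin d} (h : i ≠ μ) : e L μ i = 0 := by simp [e, h]

/-- The normalized character of a plaquette variable. -/
noncomputable def tp (L : Fin d → ℕ) (U : Config L 2) (x : Site L) (i j : Fin d) : ℝ :=
  chi (plaqSU L U x i j)

lemma tp_comm (U : Config L 2) (x : Site L) (i j : Fin d) : tp L U x i j = tp L U x j i := by
  rw [tp, ← chi_inv, tp]
  congr 1
  simp only [plaqSU]
  group

lemma abs_tp_le (U : Config L 2) (x : Site L) (i j : Fin d) : |tp L U x i j| ≤ 1 := abs_chi_le _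

lemma bddMeas_tp (x : Site L) (i j : Fin d) : BddMeas fun U : Config L 2 => tp L U x i j := by
  refine ⟨measurable_chi.comp ?_, 1, fun U => abs_tp_le U x i j⟩
  unfold plaqSU
  fun_prop

lemma dependsOn_tp {S : Set (Site L × Fin d)} {x : Site L} {i j : Fin d} (h1 : (x, i) ∈ S)
    (h2 : (x + e L i, j) ∈ S) (h3 : (x + e L j, i) ∈ S) (h4 : (x, j) ∈ S) :
    DependsOn (fun U : Config L 2 => tp L U x i j) S := by
  intro U V h
  simp only [tp, plaqSU, h _ h1, h _ h2, h _ h3, h _ h4]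

lemma pathProd_zero {N : ℕ} (U : Config L N) (x : Site L) (i : Fin d) :
    pathProd L U x i 0 = 1 := rfl

lemma pathProd_succ {N : ℕ} (U : Config L N) (x : Site L) (i : Fin d) (l : ℕ) :
    pathProd L U x i (l + 1) = pathProd L U x i l * U (x + l • e L i, i) := by
  simp [pathProd, List.range_succ]

lemma pathProd_add {N : ℕ} (U : Config L N) (x : Site L) (i : Fin d) (l l' : ℕ) :
    pathProd L U x i (l + l') = pathProd L U x i l * pathProd L U (x + l • e L i) i l' := by
  induction l' with
  | zero => simp [pathProd_zero]
  | succ n ih => rw [← add_assoc, pathProd_succ, ih, pathProd_succ, mul_assoc, add_assoc, add_smul]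

lemma pathProd_congr {N : ℕ} {U V : Config L N} {x : Site L} {i : Fin d} {l : ℕ}
    (h : ∀ j < l, U (x + j • e L i, i) = V (x + j • e L i, i)) :
    pathProd L U x i l = pathProd L V x i l := by
  induction l with
  | zero => rfl
  | succ n ih => rw [pathProd_succ, pathProd_succ, ih fun j hj => h j (by omega), h n (by omega)]

lemma dependsOn_pathProd {N : ℕ} {S : Set (Site L × Fin d)} {x : Site L} {i : Fin d} {l : ℕ}
    (h : ∀ j < l, (x + j • e L i, i) ∈ S) :
    DependsOn (fun U : Config L N => pathProd L U x i l) S :=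
  fun _ _ hUV => pathProd_congr fun j hj => hUV _ (h j hj)

lemma measurable_pathProd {N : ℕ} (x : Site L) (i : Fin d) (l : ℕ) :
    Measurable fun U : Config L N => pathProd L U x i l := by
  induction l with
  | zero => exact measurable_const
  | succ n ih =>
    simp only [pathProd_succ]
    exact ih.mul (measurable_pi_apply _)

/-- The normalized character of a rectangular loop. -/
noncomputable def wl (L : Fin d → ℕ) (U : Config L 2) (x : Site L) (μ ν : Fin d) (l l' : ℕ) : ℝ :=
  chi (rectHol L U x μ ν l l')

lemma wl_comm (U : Config L 2) (x : Site L) (μ ν : Fin d) (l l' : ℕ) :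
    wl L U x μ ν l l' = wl L U x ν μ l' l := by
  rw [wl, ← chi_inv, wl]
  congr 1
  simp only [rectHol]
  group

lemma bddMeas_wl (x : Site L) (μ ν : Fin d) (l l' : ℕ) :
    BddMeas fun U : Config L 2 => wl L U x μ ν l l' := by
  refine ⟨measurable_chi.comp ?_, 1, fun U => abs_chi_le _⟩
  exact (((measurable_pathProd _ _ _).mul (measurable_pathProd _ _ _)).mul
    (measurable_pathProd _ _ _).inv).mul (measurable_pathProd _ _ _).inv

/-! ### Reflections of the lattice -/

/-- Reflection of sites in direction `μ` about the coordinate `k`. -/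
def rs (μ : Fin d) (k : ZMod (L μ)) (x : Site L) : Site L := Function.update x μ (k + k - x μ)

variable {μ : Fin d} {k : ZMod (L μ)}

lemma rs_apply_self (x : Site L) : rs μ k x μ = k + k - x μ := by simp [rs]

lemma rs_apply_ne {i : Fin d} (h : i ≠ μ) (x : Site L) : rs μ k x i = x i := by simp [rs, h]

lemma rs_rs (x : Site L) : rs μ k (rs μ k x) = x := by
  funext i
  by_cases h : i = μ
  · subst h; simp [rs_apply_self]
  · simp [rs_apply_ne h]

lemma rs_add_e {i : Fin d} (h : i ≠ μ) (n : ℕ) (x : Site L) :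
    rs μ k (x + n • e L i) = rs μ k x + n • e L i := by
  funext j
  by_cases hj : j = μ
  · subst hj; simp [rs_apply_self, e_apply_ne h.symm]
  · simp [rs_apply_ne hj]

lemma rs_add_e_self (n : ℕ) (x : Site L) : rs μ k (x + n • e L μ) + n • e L μ = rs μ k x := by
  funext j
  by_cases hj : j = μ
  · subst hj
    simp [rs_apply_self, e_apply_self]
    ring
  · simp [rs_apply_ne hj, e_apply_ne hj]

/-- The reflection of gauge field configurations in direction `μ` about the coordinate `k`. -/
noncomputable def theta {N : ℕ} (μ : Fin d) (k : ZMod (L μ)) (U : Config L N) : Config L N :=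
  fun b => if b.2 = μ then (U (rs μ k (b.1 + e L μ), μ))⁻¹ else U (rs μ k b.1, b.2)

lemma theta_self {N : ℕ} (U : Config L N) (x : Site L) :
    theta μ k U (x, μ) = (U (rs μ k (x + e L μ), μ))⁻¹ := by simp [theta]

lemma theta_ne {N : ℕ} (U : Config L N) (x : Site L) {i : Fin d} (h : i ≠ μ) :
    theta μ k U (x, i) = U (rs μ k x, i) := by simp [theta, h]

lemma pathProd_theta_ne {N : ℕ} (U : Config L N) (x : Site L) {i : Fin d} (h : i ≠ μ) (l : ℕ) :
    pathProd L (theta μ k U) x i l = pathProd L U (rs μ k x) i l := by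
  induction l with
  | zero => rfl
  | succ n ih => rw [pathProd_succ, pathProd_succ, ih, theta_ne _ _ h, rs_add_e h]

lemma pathProd_theta_self {N : ℕ} (U : Config L N) (x : Site L) (l : ℕ) :
    pathProd L (theta μ k U) x μ l = (pathProd L U (rs μ k (x + l • e L μ)) μ l)⁻¹ := by
  induction l with
  | zero => simp [pathProd_zero]
  | succ n ih =>
    rw [pathProd_succ, ih, theta_self, ← mul_inv_rev, add_comm n 1, pathProd_add, pathProd_succ,
      pathProd_zero, one_mul, zero_smul, add_zero, add_comm 1 n, add_smul, one_smul,
      ← add_assoc]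
    have h := rs_add_e_self (μ := μ) (k := k) 1 (x + n • e L μ)
    rw [one_smul] at h
    rw [h]

/-- The base point of the reflected plaquette. -/
def rp (μ : Fin d) (k : ZMod (L μ)) (i j : Fin d) (x : Site L) : Site L :=
  if i = μ ∨ j = μ then rs μ k (x + e L μ) else rs μ k x

lemma rp_rp (i j : Fin d) (x : Site L) : rp μ k i j (rp μ k i j x) = x := by
  unfold rp
  split_ifs
  · have h := rs_add_e_self (μ := μ) (k := k) 1 x
    rw [one_smul] at h
    rw [h, rs_rs]
  · exact rs_rs x

/-- Reflection of plaquette base points as an equivalence. -/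
def rpEquiv (μ : Fin d) (k : ZMod (L μ)) (i j : Fin d) : Site L ≃ Site L :=
  ⟨rp μ k i j, rp μ k i j, rp_rp i j, rp_rp i j⟩

lemma tp_theta_self (U : Config L 2) (x : Site L) {j : Fin d} (hj : j ≠ μ) :
    tp L (theta μ k U) x μ j = tp L U (rs μ k (x + e L μ)) μ j := by
  have h1 := rs_add_e_self (μ := μ) (k := k) 1 x
  have h2 := rs_add_e (k := k) hj 1 (x + e L μ)
  rw [one_smul] at h1 h2
  rw [tp, tp, ← chi_inv (plaqSU L U _ _ _), plaqSU, plaqSU, theta_self, theta_self, theta_ne _ _ hj,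
    theta_ne _ _ hj, add_right_comm, h2, h1, inv_inv, mul_assoc, mul_assoc, chi_mul_comm]
  congr 1
  group

lemma tp_theta (U : Config L 2) (x : Site L) {i j : Fin d} (hij : i ≠ j) :
    tp L (theta μ k U) x i j = tp L U (rp μ k i j x) i j := by
  by_cases hi : i = μ
  · subst hi
    rw [tp_theta_self _ _ hij.symm]
    simp [rp]
  by_cases hj : j = μ
  · subst hj
    rw [tp_comm, tp_theta_self _ _ hij, tp_comm]
    simp [rp]
  · have h2 := rs_add_e (k := k) hj 1 x
    have h1 := rs_add_e (k := k) hi 1 x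
    rw [one_smul] at h1 h2
    simp [tp, plaqSU, theta_ne, hi, hj, rp, h1, h2]

/-! ### Heights -/

/-- The height of a site above the hyperplane with `μ`-coordinate `k`. -/
def ht (μ : Fin d) (k : ZMod (L μ)) (x : Site L) : ℕ := (x μ - k).val

lemma ht_add_e_ne {i : Fin d} (h : i ≠ μ) (n : ℕ) (x : Site L) :
    ht μ k (x + n • e L i) = ht μ k x := by
  simp [ht, e_apply_ne h.symm]

lemma ht_eq_zero {x : Site L} (h : x μ = k) : ht μ k x = 0 := by simp [ht, h]

variable {M : ℕ}

/-- The links on one side of the reflection hyperplanes. -/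
def sideL (μ : Fin d) (k : ZMod (L μ)) (M : ℕ) : Set (Site L × Fin d) :=
  {b | if b.2 = μ then ht μ k b.1 < M else ht μ k b.1 ≤ M}

/-- The links inside the reflection hyperplanes. -/
def planeL (μ : Fin d) (k : ZMod (L μ)) (M : ℕ) : Set (Site L × Fin d) :=
  {b | b.2 ≠ μ ∧ (ht μ k b.1 = 0 ∨ ht μ k b.1 = M)}

lemma mem_sideL_self {x : Site L} : (x, μ) ∈ sideL μ k M ↔ ht μ k x < M := by
  simp [sideL]

lemma mem_sideL_ne {x : Site L} {i : Fin d} (h : i ≠ μ) :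
    (x, i) ∈ sideL μ k M ↔ ht μ k x ≤ M := by
  simp [sideL, h]

lemma mem_planeL {x : Site L} {i : Fin d} (h : i ≠ μ) :
    (x, i) ∈ planeL μ k M ↔ ht μ k x = 0 ∨ ht μ k x = M := by
  simp [planeL, h]

variable [∀ i, NeZero (L i)]

lemma ht_lt (x : Site L) : ht μ k x < L μ := ZMod.val_lt _

lemma val_add_one_eq {n : ℕ} [NeZero n] (a : ZMod n) :
    (a + 1).val = if a.val + 1 = n then 0 else a.val + 1 := by
  have ha := ZMod.val_lt a
  have : a + 1 = ((a.val + 1 : ℕ) : ZMod n) := by simp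
  rw [this, ZMod.val_natCast]
  split_ifs with h
  · rw [h, Nat.mod_self]
  · exact Nat.mod_eq_of_lt (by omega)

lemma val_neg_eq {n : ℕ} [NeZero n] (a : ZMod n) :
    (-a).val = if a.val = 0 then 0 else n - a.val := by
  rw [ZMod.neg_val]
  simp [ZMod.val_eq_zero]

lemma ht_add_e_self (x : Site L) :
    ht μ k (x + e L μ) = if ht μ k x + 1 = L μ then 0 else ht μ k x + 1 := by
  rw [ht, ht, ← val_add_one_eq]
  congr 1
  simp [e_apply_self]
  ring

lemma ht_add_smul_self (x : Site L) (n : ℕ) (h : ht μ k x + n < L μ) :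
    ht μ k (x + n • e L μ) = ht μ k x + n := by
  induction n with
  | zero => simp
  | succ n ih =>
    rw [add_smul, one_smul, ← add_assoc, ht_add_e_self, ih (by omega), if_neg (by omega)]
    ring

lemma ht_rs (x : Site L) : ht μ k (rs μ k x) = if ht μ k x = 0 then 0 else L μ - ht μ k x := by
  rw [ht, ht, ← val_neg_eq, rs_apply_self]
  congr 1
  ring

lemma ht_rs_add_e (x : Site L) : ht μ k (rs μ k (x + e L μ)) = L μ - 1 - ht μ k x := by
  have := ht_lt (k := k) x
  rw [ht_rs, ht_add_e_self]
  split_ifs <;> first | omega | contradiction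

lemma rs_eq_self (hM : L μ = 2 * M) {x : Site L} (h : ht μ k x = 0 ∨ ht μ k x = M) :
    rs μ k x = x := by
  funext i
  by_cases hi : i = μ
  · subst hi
    have h1 : ht i k (rs i k x) = ht i k x := by
      rw [ht_rs]
      split_ifs <;> omega
    exact sub_left_injective (ZMod.val_injective _ h1)
  · exact rs_apply_ne hi x

lemma theta_eq_of_mem_planeL (hM : L μ = 2 * M) {N : ℕ} (U : Config L N) {b : Site L × Fin d}
    (hb : b ∈ planeL μ k M) : theta μ k U b = U b := by
  obtain ⟨x, i⟩ := b
  rw [theta_ne _ _ hb.1, rs_eq_self hM hb.2]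

lemma measurePreserving_theta {N : ℕ} (μH : Measure (SU N)) [IsProbabilityMeasure μH]
    (hHaar : ∀ g : SU N, Measure.map (fun u => g * u) μH = μH) :
    MeasurePreserving (theta μ k : Config L N → Config L N) (Pm L μH) (Pm L μH) := by
  let σ : Site L × Fin d → Site L × Fin d :=
    fun b => if b.2 = μ then (rs μ k (b.1 + e L μ), b.2) else (rs μ k b.1, b.2)
  have hσ : Function.Involutive σ := by
    rintro ⟨x, i⟩
    by_cases hi : i = μ
    · subst hi
      have h1 := rs_add_e_self (μ := i) (k := k) 1 x
      rw [one_smul] at h1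
      simp [σ, h1, rs_rs]
    · simp [σ, hi, rs_rs]
  have h := measurePreserving_pi_perm μH hσ.toPerm (fun b u => if b.2 = μ then u⁻¹ else u)
    fun b => by
      by_cases hb : b.2 = μ
      · simpa [hb] using measurePreserving_inv_of_left_invariant μH hHaar
      · simp only [hb, if_false]
        exact MeasurePreserving.id μH
  rw [Pm]
  convert h using 1
  funext U b
  obtain ⟨x, i⟩ := b
  by_cases hi : i = μ
  · subst hi
    simp [theta, σ]
  · simp [theta, hi, σ]

lemma isReflection_theta (hM : L μ = 2 * M) {N : ℕ} (μH : Measure (SU N))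
    [IsProbabilityMeasure μH] (hHaar : ∀ g : SU N, Measure.map (fun u => g * u) μH = μH) :
    IsReflection μH (sideL μ k M) (planeL μ k M) (theta μ k : Config L N → Config L N) where
  subset := by
    rintro ⟨x, i⟩ ⟨h1, h2⟩
    rw [mem_sideL_ne h1]
    rcases h2 with h2 | h2 <;> simp only at h2 <;> omega
  measurePreserving := measurePreserving_theta μH hHaar
  fix := fun U b hb => theta_eq_of_mem_planeL hM U hb
  swap := by
    rintro ⟨x, i⟩ ⟨h1, h2⟩ U V h
    have hx := ht_lt (k := k) x
    by_cases hi : i = μ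
    · subst hi
      rw [mem_sideL_self] at h1
      simp only [theta_self]
      rw [h]
      rw [Set.mem_compl_iff, mem_sideL_self, ht_rs_add_e]
      omega
    · rw [mem_sideL_ne hi] at h1
      rw [mem_planeL hi, not_or] at h2
      simp only [theta_ne _ _ hi]
      apply h
      rw [Set.mem_compl_iff, mem_sideL_ne hi, ht_rs, if_neg h2.1]
      omega

end Lattice

/-! ### The action, vortex operators and center flips -/

section Action

variable {d : ℕ} {L : Fin d → ℕ}

section

variable {μ ν : Fin d} {k : ZMod (L μ)} {a : ZMod (L μ)} {b : ZMod (L ν)} {M : ℕ}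

lemma dependsOn_tp_sideL_ne {x : Site L} {i j : Fin d} (hi : i ≠ μ) (hj : j ≠ μ)
    (h : ht μ k x ≤ M) : DependsOn (fun U : Config L 2 => tp L U x i j) (sideL μ k M) := by
  have h1 := ht_add_e_ne (k := k) hj 1 x
  have h2 := ht_add_e_ne (k := k) hi 1 x
  rw [one_smul] at h1 h2
  refine dependsOn_tp ?_ ?_ ?_ ?_
  · rwa [mem_sideL_ne hi]
  · rwa [mem_sideL_ne hj, h2]
  · rwa [mem_sideL_ne hi, h1]
  · rwa [mem_sideL_ne hj]

/-- Multiply the links in direction `ν` based at sites with coordinates `(a, b)` by `-1`. -/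
noncomputable def flip (μ ν : Fin d) (a : ZMod (L μ)) (b : ZMod (L ν)) (U : Config L 2) :
    Config L 2 :=
  fun c => if c.2 = ν ∧ c.1 μ = a ∧ c.1 ν = b then negOne * U c else U c

/-- The sign picked up by a link variable under a center flip. -/
noncomputable def flipSign (μ ν : Fin d) (a : ZMod (L μ)) (b : ZMod (L ν)) (c : Site L × Fin d) :
    ℝ :=
  if c.2 = ν ∧ c.1 μ = a ∧ c.1 ν = b then -1 else 1

lemma quat_flip (U : Config L 2) (c : Site L × Fin d) :
    quat (flip μ ν a b U c) = flipSign μ ν a b c • quat (U c) := by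
  unfold flip flipSign
  split_ifs
  · rw [quat_mul, quat_negOne, neg_one_mul, neg_one_smul]
  · rw [one_smul]

lemma tp_flip (U : Config L 2) (x : Site L) (i j : Fin d) :
    tp L (flip μ ν a b U) x i j = flipSign μ ν a b (x, i) * flipSign μ ν a b (x + e L i, j) *
      flipSign μ ν a b (x + e L j, i) * flipSign μ ν a b (x, j) * tp L U x i j := by
  simp only [tp, plaqSU, chi, quat_mul, quat_inv, quat_flip, Quaternion.star_smul, smul_mul_assoc,
    mul_smul_comm, smul_smul, Quaternion.re_smul, smul_eq_mul]
  ring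

lemma tp_flip_self (hμν : μ ≠ ν) (hL : 2 ≤ L μ) (U : Config L 2) (x : Site L) :
    tp L (flip μ ν a b U) x μ ν =
      (if (x μ = a ∧ x ν = b) ∨ (x μ = a - 1 ∧ x ν = b) then -1 else 1) * tp L U x μ ν := by
  rw [tp_flip]
  congr 1
  have h10 : (1 : ZMod (L μ)) ≠ 0 := by
    have : Fact (1 < L μ) := ⟨hL⟩
    exact one_ne_zero
  have h1 : x μ + 1 = a ↔ x μ = a - 1 := eq_sub_iff_add_eq.symm
  simp only [flipSign, hμν, false_and, if_false, true_and, Pi.add_apply, e_apply_self,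
    e_apply_ne hμν.symm, add_zero, h1]
  by_cases ha : x μ = a
  · have : ¬ a = a - 1 := fun h => h10 (sub_eq_self.1 h.symm)
    by_cases hb : x ν = b <;> simp [ha, hb, this]
  · by_cases hb : x ν = b <;> simp [ha, hb]

lemma tp_flip_of_ne (U : Config L 2) (x : Site L) {i j : Fin d} (hij : i ≠ j)
    (h1 : ¬ (i = μ ∧ j = ν)) (h2 : ¬ (i = ν ∧ j = μ)) :
    tp L (flip μ ν a b U) x i j = tp L U x i j := by
  rw [tp_flip]
  by_cases hi : i = ν
  · subst hi
    have hj : j ≠ μ := fun h => h2 ⟨rfl, h⟩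
    simp only [flipSign, hij.symm, false_and, if_false, true_and, Pi.add_apply,
      e_apply_ne hj.symm, e_apply_ne hij, add_zero]
    split_ifs <;> ring
  by_cases hj : j = ν
  · subst hj
    have hi' : i ≠ μ := fun h => h1 ⟨h, rfl⟩
    simp only [flipSign, hij, false_and, if_false, true_and, Pi.add_apply,
      e_apply_ne hi'.symm, e_apply_ne hij.symm, add_zero]
    split_ifs <;> ring
  · simp [flipSign, hi, hj]

lemma pathProd_flip_of_ne (hμν : μ ≠ ν) (U : Config L 2) (x : Site L) (l : ℕ) :
    pathProd L (flip μ ν a b U) x μ l = pathProd L U x μ l :=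
  pathProd_congr fun j _ => by simp [flip, hμν]

lemma pathProd_flip_of_coord_ne (hμν : μ ≠ ν) (U : Config L 2) {x : Site L} (hx : x μ ≠ a)
    (l : ℕ) : pathProd L (flip μ ν a b U) x ν l = pathProd L U x ν l :=
  pathProd_congr fun j _ => by simp [flip, e_apply_ne hμν, hx]

lemma pathProd_flip_self (U : Config L 2) {x : Site L} (hxa : x μ = a)
    (hxb : x ν = b) {l : ℕ} (hl : 0 < l) (hl' : l < L ν) :
    pathProd L (flip μ ν a b U) x ν l = negOne * pathProd L U x ν l := by
  obtain ⟨n, rfl⟩ := Nat.exists_eq_succ_of_ne_zero hl.ne'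
  rw [Nat.succ_eq_add_one, add_comm, pathProd_add, pathProd_add, ← mul_assoc]
  congr 1
  · simp [pathProd_succ, pathProd_zero, flip, hxa, hxb]
  · refine pathProd_congr fun j hj => ?_
    have : ((1 + j : ℕ) : ZMod (L ν)) ≠ 0 := by
      rw [Ne, ZMod.natCast_eq_zero_iff]
      intro h
      have := Nat.le_of_dvd (by omega) h
      omega
    push_cast at this
    simp [flip, hxb, e_apply_self, add_assoc, this]

end

variable [∀ i, NeZero (L i)] {β : ℝ}

lemma S0_eq (U : Config L 2) :
    S0 L β U = β * ∑ i, ∑ j, if i < j then ∑ x, tp L U x i j else 0 := by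
  rw [S0, Finset.sum_comm]
  simp only [Finset.mul_sum]
  refine Finset.sum_congr rfl fun i _ => ?_
  rw [Finset.sum_comm]
  refine Finset.sum_congr rfl fun j _ => ?_
  split_ifs
  · rw [Finset.mul_sum]
    refine Finset.sum_congr rfl fun x _ => ?_
    rw [trace_toM_re_eq, tp]
    push_cast
    ring
  · simp

variable {μ : Fin d} {k : ZMod (L μ)} {M : ℕ}

/-- The weight with which a plaquette enters the action of one side of a reflection. -/
noncomputable def cwt (μ : Fin d) (k : ZMod (L μ)) (M : ℕ) (i j : Fin d) (x : Site L) : ℝ :=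
  if i = μ ∨ j = μ then if ht μ k x < M then 1 else 0
  else if ht μ k x = 0 ∨ ht μ k x = M then 1 / 2 else if ht μ k x < M then 1 else 0

lemma cwt_add_cwt_rp (hM : L μ = 2 * M) (i j : Fin d) (x : Site L) :
    cwt μ k M i j x + cwt μ k M i j (rp μ k i j x) = 1 := by
  have hx := ht_lt (k := k) x
  unfold cwt rp
  by_cases hij : i = μ ∨ j = μ
  · simp only [hij, if_true, ht_rs_add_e]
    split_ifs <;> first | omega | norm_num
  · simp only [hij, if_false, ht_rs]
    split_ifs <;> first | omega | norm_num

/-- The part of the action on one side of a reflection. -/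
noncomputable def halfS (β : ℝ) (μ : Fin d) (k : ZMod (L μ)) (M : ℕ) (U : Config L 2) : ℝ :=
  β * ∑ i, ∑ j, if i < j then ∑ x, cwt μ k M i j x * tp L U x i j else 0

lemma halfS_add_theta (hM : L μ = 2 * M) (U : Config L 2) :
    halfS β μ k M U + halfS β μ k M (theta μ k U) = S0 L β U := by
  rw [S0_eq, halfS, halfS, ← mul_add]
  simp only [← Finset.sum_add_distrib]
  congr 1
  refine Finset.sum_congr rfl fun i _ => Finset.sum_congr rfl fun j _ => ?_
  split_ifs with hij
  · have h : ∑ x, cwt μ k M i j x * tp L (theta μ k U) x i j =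
        ∑ x, cwt μ k M i j (rp μ k i j x) * tp L U x i j := by
      rw [← Equiv.sum_comp (rpEquiv μ k i j)]
      refine Finset.sum_congr rfl fun x _ => ?_
      rw [tp_theta _ _ hij.ne]
      change _ * tp L U (rp μ k i j (rp μ k i j x)) i j = _
      rw [rp_rp]
      rfl
    rw [h, ← Finset.sum_add_distrib]
    refine Finset.sum_congr rfl fun x _ => ?_
    rw [← add_mul, cwt_add_cwt_rp hM, one_mul]
  · simp

lemma bddMeas_halfS : BddMeas (halfS β μ k M : Config L 2 → ℝ) :=
  (BddMeas.sum _ fun _ _ => BddMeas.sum _ fun _ _ => BddMeas.ite _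
    (BddMeas.sum _ fun _ _ => (bddMeas_tp _ _ _).const_mul _) (bddMeas_const 0)).const_mul _

lemma dependsOn_tp_sideL_self (hM : L μ = 2 * M) {x : Site L} {j : Fin d} (hj : j ≠ μ)
    (h : ht μ k x < M) : DependsOn (fun U : Config L 2 => tp L U x μ j) (sideL μ k M) := by
  have h1 := ht_add_e_ne (k := k) hj 1 x
  rw [one_smul] at h1
  refine dependsOn_tp ?_ ?_ ?_ ?_
  · rwa [mem_sideL_self]
  · rw [mem_sideL_ne hj, ht_add_e_self]
    split_ifs <;> omega
  · rwa [mem_sideL_self, h1]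
  · rw [mem_sideL_ne hj]
    omega

lemma dependsOn_halfS (hM : L μ = 2 * M) :
    DependsOn (halfS β μ k M : Config L 2 → ℝ) (sideL μ k M) := by
  intro U V h
  unfold halfS
  refine congrArg (β * ·) ?_
  refine Finset.sum_congr rfl fun i _ => Finset.sum_congr rfl fun j _ => ?_
  split_ifs with hij
  swap
  · rfl
  refine Finset.sum_congr rfl fun x _ => ?_
  by_cases hc : cwt μ k M i j x = 0
  · simp [hc]
  refine congrArg (cwt μ k M i j x * ·) ?_
  unfold cwt at hc
  by_cases hi : i = μ
  · subst hi
    refine dependsOn_tp_sideL_self hM hij.ne' ?_ h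
    by_contra hx
    simp [hx] at hc
  by_cases hj : j = μ
  · subst hj
    rw [tp_comm, tp_comm V]
    refine dependsOn_tp_sideL_self hM hij.ne ?_ h
    by_contra hx
    simp [hx] at hc
  · refine dependsOn_tp_sideL_ne hi hj ?_ h
    by_contra hx
    have h1 : ¬ ht μ k x < M := by omega
    have h2 : ¬ (ht μ k x = 0 ∨ ht μ k x = M) := by omega
    simp [hi, hj, h1, h2] at hc

lemma wt_eq (hM : L μ = 2 * M) (U : Config L 2) :
    wt L β U = Real.exp (halfS β μ k M U) * Real.exp (halfS β μ k M (theta μ k U)) := by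
  rw [← Real.exp_add, halfS_add_theta hM, wt]

lemma bddMeas_wt : BddMeas (wt L β : Config L 2 → ℝ) := by
  have : BddMeas (S0 L β : Config L 2 → ℝ) := by
    have h : (S0 L β : Config L 2 → ℝ) =
        fun U => β * ∑ i, ∑ j, if i < j then ∑ x, tp L U x i j else 0 := funext S0_eq
    rw [h]
    exact (BddMeas.sum _ fun _ _ => BddMeas.sum _ fun _ _ => BddMeas.ite _
      (BddMeas.sum _ fun _ _ => bddMeas_tp _ _ _) (bddMeas_const 0)).const_mul _
  exact this.exp

/-! Vortex operators -/

/-- The logarithm of the operator creating a vortex at coordinates `(a, b)`. -/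
noncomputable def logO (β : ℝ) (μ ν : Fin d) (a : ZMod (L μ)) (b : ZMod (L ν)) (U : Config L 2) :
    ℝ :=
  -(2 * β) * ∑ x : Site L, if x μ = a ∧ x ν = b then tp L U x μ ν else 0

/-- The operator creating a vortex at coordinates `(a, b)`. -/
noncomputable def Ow (β : ℝ) (μ ν : Fin d) (a : ZMod (L μ)) (b : ZMod (L ν)) (U : Config L 2) :
    ℝ :=
  Real.exp (logO β μ ν a b U)

/-- The electric flux operator of a vortex at coordinates `(a, b)`. -/
noncomputable def Fw (β : ℝ) (μ ν : Fin d) (a : ZMod (L μ)) (b : ZMod (L ν)) (U : Config L 2) :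
    ℝ :=
  (1 - Ow β μ ν a b U) / 2

variable {ν : Fin d} {a : ZMod (L μ)} {b : ZMod (L ν)}

lemma Ovort_eq (U : Config L 2) : Ovort L β a b 1 U = Ow β μ ν a b U := by
  rw [Ovort, Ow, logO, zc_two]
  congr 1
  rw [Finset.mul_sum, Finset.mul_sum]
  refine Finset.sum_congr rfl fun x _ => ?_
  split_ifs
  · have h := trace_toM_re_eq (plaqSU L U x μ ν)
    rw [pow_one, neg_one_mul, Complex.neg_re, h, tp]
    push_cast
    ring
  · simp

lemma Ow_comm (U : Config L 2) : Ow β μ ν a b U = Ow β ν μ b a U := by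
  simp only [Ow, logO, and_comm, tp_comm U _ μ ν]

lemma Fw_comm (U : Config L 2) : Fw β μ ν a b U = Fw β ν μ b a U := by
  rw [Fw, Ow_comm, Fw]

lemma bddMeas_Ow : BddMeas (Ow β μ ν a b) :=
  ((BddMeas.sum _ fun _ _ => BddMeas.ite _ (bddMeas_tp _ _ _) (bddMeas_const 0)).const_mul _).exp

lemma bddMeas_Fw : BddMeas (Fw β μ ν a b) := by
  have := ((bddMeas_const 1).sub (bddMeas_Ow (β := β) (a := a) (b := b))).const_mul (1 / 2)
  convert this using 2
  rw [Fw]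
  ring

lemma Fw_theta (hμν : μ ≠ ν) (U : Config L 2) :
    Fw β μ ν a b (theta μ k U) = Fw β μ ν (k + k - a - 1) b U := by
  rw [Fw, Fw, Ow, Ow, logO, logO, ← Equiv.sum_comp (rpEquiv μ k μ ν)]
  congr 5
  funext x
  rw [tp_theta _ _ hμν]
  change (if rp μ k μ ν x μ = a ∧ rp μ k μ ν x ν = b then
    tp L U (rp μ k μ ν (rp μ k μ ν x)) μ ν else 0) = _
  rw [rp_rp]
  have h1 : rp μ k μ ν x μ = k + k - x μ - 1 := by
    simp [rp, rs_apply_self, e_apply_self]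
    ring
  have h2 : rp μ k μ ν x ν = x ν := by
    simp [rp, rs_apply_ne hμν.symm, e_apply_ne hμν.symm]
  rw [h1, h2]
  have h3 : k + k - x μ - 1 = a ↔ x μ = k + k - a - 1 := by
    constructor
    · rintro rfl
      ring
    · intro h
      rw [h]
      ring
  simp only [h3]

lemma dependsOn_Fw (hμν : μ ≠ ν) (hM : L μ = 2 * M) (ha : (a - k).val < M) :
    DependsOn (Fw β μ ν a b : Config L 2 → ℝ) (sideL μ k M) := by
  intro U V h
  unfold Fw Ow logO
  congr 4
  refine Finset.sum_congr rfl fun x _ => ?_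
  split_ifs with hx
  · refine dependsOn_tp_sideL_self hM hμν.symm ?_ h
    rwa [ht, hx.1]
  · rfl

/-! Center flips -/

lemma measurePreserving_flip (μH : Measure (SU 2)) [IsProbabilityMeasure μH]
    (hHaar : ∀ g : SU 2, Measure.map (fun u => g * u) μH = μH) :
    MeasurePreserving (flip μ ν a b) (Pm L μH) (Pm L μH) := by
  refine measurePreserving_pi_perm μH (Equiv.refl _)
    (fun (c : Site L × Fin d) u => if c.2 = ν ∧ c.1 μ = a ∧ c.1 ν = b then negOne * u else u)
    fun c => ?_
  split_ifs
  · exact ⟨measurable_const_mul _, hHaar _⟩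
  · exact MeasurePreserving.id μH

lemma logO_flip (hμν : μ ≠ ν) (hL : 2 ≤ L μ) (a' : ZMod (L μ)) (b' : ZMod (L ν))
    (U : Config L 2) :
    logO β μ ν a' b' (flip μ ν a b U) =
      (if (a' = a ∧ b' = b) ∨ (a' = a - 1 ∧ b' = b) then -1 else 1) * logO β μ ν a' b' U := by
  unfold logO
  rw [mul_left_comm]
  congr 1
  rw [Finset.mul_sum]
  refine Finset.sum_congr rfl fun x _ => ?_
  by_cases hx : x μ = a' ∧ x ν = b'
  · rw [if_pos hx, if_pos hx, tp_flip_self hμν hL, hx.1, hx.2]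
  · rw [if_neg hx, if_neg hx, mul_zero]

lemma S0_flip (hμν : μ ≠ ν) (hL : 2 ≤ L μ) (U : Config L 2) :
    S0 L β (flip μ ν a b U) = S0 L β U + logO β μ ν a b U + logO β μ ν (a - 1) b U := by
  have h10 : (1 : ZMod (L μ)) ≠ 0 := by
    have : Fact (1 < L μ) := ⟨hL⟩
    exact one_ne_zero
  have haa : ¬ a = a - 1 := fun h => h10 (sub_eq_self.1 h.symm)
  have hD : ∑ x, tp L (flip μ ν a b U) x μ ν = ∑ x, tp L U x μ ν -
      2 * ∑ x, (if x μ = a ∧ x ν = b then tp L U x μ ν else 0) -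
      2 * ∑ x, (if x μ = a - 1 ∧ x ν = b then tp L U x μ ν else 0) := by
    rw [Finset.mul_sum, Finset.mul_sum, ← Finset.sum_sub_distrib, ← Finset.sum_sub_distrib]
    refine Finset.sum_congr rfl fun x _ => ?_
    rw [tp_flip_self hμν hL]
    by_cases ha : x μ = a
    · by_cases hb : x ν = b
      · simp [ha, hb, haa]
        ring
      · simp [hb]
    · by_cases hb : x ν = b
      · by_cases ha' : x μ = a - 1
        · have : ¬ a - 1 = a := fun h => haa h.symm
          simp [ha', hb, this]
          ring
        · simp [ha, ha']
      · simp [hb]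
  have hs : ∀ i j : Fin d, (if i < j then ∑ x, tp L (flip μ ν a b U) x i j else 0) =
      (if i < j then ∑ x, tp L U x i j else 0) +
        if i < j ∧ ((i = μ ∧ j = ν) ∨ (i = ν ∧ j = μ)) then
          ∑ x, tp L (flip μ ν a b U) x μ ν - ∑ x, tp L U x μ ν else 0 := by
    intro i j
    by_cases hij : i < j
    · simp only [hij, if_true, true_and]
      by_cases h1 : i = μ ∧ j = ν
      · simp [h1]
      by_cases h2 : i = ν ∧ j = μ
      · simp [h2, tp_comm _ _ ν μ]
      · simp only [h1, h2, or_self, if_false, add_zero]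
        exact Finset.sum_congr rfl fun x _ => tp_flip_of_ne U x hij.ne h1 h2
    · simp [hij]
  have hcount : ∀ D : ℝ, (∑ i : Fin d, ∑ j : Fin d,
      if i < j ∧ ((i = μ ∧ j = ν) ∨ (i = ν ∧ j = μ)) then D else 0) = D := by
    intro D
    rcases lt_or_gt_of_ne hμν with h | h
    · rw [Finset.sum_eq_single μ, Finset.sum_eq_single ν]
      · simp [h]
      · intro j _ hj
        simp [hj, hμν]
      · simp
      · intro i _ hi
        refine Finset.sum_eq_zero fun j _ => if_neg ?_
        rintro ⟨h1, ⟨rfl, rfl⟩ | ⟨rfl, rfl⟩⟩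
        · exact hi rfl
        · exact lt_asymm h h1
      · simp
    · rw [Finset.sum_eq_single ν, Finset.sum_eq_single μ]
      · simp [h]
      · intro j _ hj
        simp [hj, hμν.symm]
      · simp
      · intro i _ hi
        refine Finset.sum_eq_zero fun j _ => if_neg ?_
        rintro ⟨h1, ⟨rfl, rfl⟩ | ⟨rfl, rfl⟩⟩
        · exact lt_asymm h h1
        · exact hi rfl
      · simp
  rw [S0_eq, S0_eq]
  simp only [hs, Finset.sum_add_distrib]
  rw [hcount, hD, logO, logO]
  ring

lemma wt_flip (hμν : μ ≠ ν) (hL : 2 ≤ L μ) (U : Config L 2) :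
    wt L β (flip μ ν a b U) = Ow β μ ν a b U * Ow β μ ν (a - 1) b U * wt L β U := by
  rw [wt, S0_flip hμν hL, Real.exp_add, Real.exp_add, Ow, Ow, wt]
  ring

lemma Ow_flip (hμν : μ ≠ ν) (hL : 2 ≤ L μ) (U : Config L 2) :
    Ow β μ ν a b (flip μ ν a b U) * Ow β μ ν a b U = 1 := by
  rw [Ow, Ow, logO_flip hμν hL, ← Real.exp_add]
  simp

lemma Fw_flip_of_ne (hμν : μ ≠ ν) (hL : 2 ≤ L μ) {a' : ZMod (L μ)} {b' : ZMod (L ν)}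
    (h : b' ≠ b) (U : Config L 2) : Fw β μ ν a' b' (flip μ ν a b U) = Fw β μ ν a' b' U := by
  rw [Fw, Fw, Ow, Ow, logO_flip hμν hL]
  simp [h]

end Action

/-! ### Expectation values -/

section Expectation

variable {d : ℕ} {L : Fin d → ℕ} [∀ i, NeZero (L i)] {β : ℝ} {μH : Measure (SU 2)}
  [IsProbabilityMeasure μH]

instance : IsProbabilityMeasure (Pm L μH) := by
  unfold Pm
  infer_instance

lemma Zpart_pos : 0 < Zpart L μH β :=
  integral_exp_pos ((bddMeas_wt (L := L) (β := β)).integrable (Pm L μH))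

lemma expecR_one : expecR L μH β (fun _ => 1) = 1 := by
  simp only [expecR, one_mul]
  exact div_self Zpart_pos.ne'

lemma expecR_mono {f g : Config L 2 → ℝ} (hf : BddMeas f) (hg : BddMeas g) (h : ∀ U, f U ≤ g U) :
    expecR L μH β f ≤ expecR L μH β g := by
  refine div_le_div_of_nonneg_right ?_ Zpart_pos.le
  exact integral_mono ((hf.mul bddMeas_wt).integrable _) ((hg.mul bddMeas_wt).integrable _)
    fun U => mul_le_mul_of_nonneg_right (h U) (Real.exp_pos _).le

lemma expecR_le_one {f : Config L 2 → ℝ} (hf : BddMeas f) (h : ∀ U, f U ≤ 1) :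
    expecR L μH β f ≤ 1 :=
  (expecR_mono hf (bddMeas_const 1) h).trans_eq expecR_one

lemma expecR_add {f g : Config L 2 → ℝ} (hf : BddMeas f) (hg : BddMeas g) :
    expecR L μH β (fun U => f U + g U) = expecR L μH β f + expecR L μH β g := by
  simp only [expecR, add_mul]
  rw [integral_add ((hf.mul bddMeas_wt).integrable _) ((hg.mul bddMeas_wt).integrable _), add_div]

lemma expecR_const_mul (c : ℝ) (f : Config L 2 → ℝ) :
    expecR L μH β (fun U => c * f U) = c * expecR L μH β f := by
  simp only [expecR, mul_assoc]
  rw [integral_const_mul, mul_div_assoc]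

lemma expecR_sub {f g : Config L 2 → ℝ} (hf : BddMeas f) (hg : BddMeas g) :
    expecR L μH β (fun U => f U - g U) = expecR L μH β f - expecR L μH β g := by
  have := expecR_add (β := β) (μH := μH) hf (hg.const_mul (-1))
  rw [expecR_const_mul] at this
  simp only [neg_one_mul, ← sub_eq_add_neg] at this
  exact this

lemma expecR_neg (f : Config L 2 → ℝ) :
    expecR L μH β (fun U => - f U) = - expecR L μH β f := by
  simpa using expecR_const_mul (β := β) (μH := μH) (-1) f

variable {μ ν : Fin d}

lemma expecR_Fw (a : ZMod (L μ)) (b : ZMod (L ν)) :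
    expecR L μH β (Fw β μ ν a b) = 1 / 2 * (1 - expecR L μH β (Ow β μ ν a b)) := by
  have h := expecR_sub (β := β) (μH := μH) (bddMeas_const 1)
    (bddMeas_Ow (β := β) (a := a) (b := b))
  rw [expecR_one] at h
  rw [← h, ← expecR_const_mul]
  congr 1
  funext U
  rw [Fw]
  ring

variable (hHaar : ∀ g : SU 2, Measure.map (fun u => g * u) μH = μH)

include hHaar

lemma bddMeas_theta {f : Config L 2 → ℝ} (hf : BddMeas f) (k : ZMod (L μ)) :
    BddMeas fun U => f (theta μ k U) :=
  hf.comp (measurePreserving_theta μH hHaar).measurable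

/-- Reflection positivity in the form of a Cauchy–Schwarz inequality. -/
lemma expecR_cauchySchwarz {M : ℕ} (hM : L μ = 2 * M) (k : ZMod (L μ)) {κ : Type*} [Fintype κ]
    {a f : κ → Config L 2 → ℝ} {g : Config L 2 → ℝ} (ha : ∀ n, BddMeas (a n))
    (haP : ∀ n, DependsOn (a n) (planeL μ k M)) (ha1 : ∀ U, ∑ n, a n U ^ 2 ≤ 1)
    (hf : ∀ n, BddMeas (f n)) (hfΛ : ∀ n, DependsOn (f n) (sideL μ k M))
    (hg : BddMeas g) (hgΛ : DependsOn g (sideL μ k M)) :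
    expecR L μH β (fun U => (∑ n, a n U * f n U) * g (theta μ k U)) ^ 2 ≤
      expecR L μH β (fun U => ∑ n, f n U * f n (theta μ k U)) *
        expecR L μH β (fun U => g U * g (theta μ k U)) := by
  have h := (isReflection_theta (k := k) hM μH hHaar).cauchySchwarz ha haP ha1 hf hfΛ hg hgΛ
    (bddMeas_halfS (β := β) (k := k) (M := M)).exp
    (fun U V h => congrArg Real.exp (dependsOn_halfS hM h))
  simp only [← wt_eq hM] at h
  rw [expecR, expecR, expecR, div_pow, div_mul_div_comm, ← sq]
  exact div_le_div_of_nonneg_right h (sq_nonneg _)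

lemma expecR_mul_reflect_le {M : ℕ} (hM : L μ = 2 * M) (k : ZMod (L μ))
    {a f : Config L 2 → ℝ} (ha : BddMeas a) (haP : DependsOn a (planeL μ k M))
    (ha1 : ∀ U, a U ≤ 1) (hf : BddMeas f) (hfΛ : DependsOn f (sideL μ k M)) :
    expecR L μH β (fun U => a U * (f U * f (theta μ k U))) ≤
      expecR L μH β (fun U => f U * f (theta μ k U)) := by
  have h := (isReflection_theta (k := k) hM μH hHaar).integral_mul_le ha haP ha1 hf hfΛ
    (bddMeas_halfS (β := β) (k := k) (M := M)).exp
    (fun U V h => congrArg Real.exp (dependsOn_halfS hM h))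
  simp only [← wt_eq hM] at h
  exact div_le_div_of_nonneg_right h Zpart_pos.le

lemma expecR_reflect_nonneg {M : ℕ} (hM : L μ = 2 * M) (k : ZMod (L μ))
    {f : Config L 2 → ℝ} (hf : BddMeas f) (hfΛ : DependsOn f (sideL μ k M)) :
    0 ≤ expecR L μH β (fun U => f U * f (theta μ k U)) := by
  have h := expecR_mul_reflect_le (β := β) hHaar hM k (bddMeas_const 0)
    (fun _ _ _ => rfl) (fun _ => zero_le_one) hf hfΛ
  simp only [zero_mul] at h
  simpa [expecR] using h

variable {a : ZMod (L μ)} {b : ZMod (L ν)}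

lemma expecR_flip (hμν : μ ≠ ν) (hL : 2 ≤ L μ) {h : Config L 2 → ℝ} (hh : BddMeas h) :
    expecR L μH β (fun U => h (flip μ ν a b U) * (Ow β μ ν a b U * Ow β μ ν (a - 1) b U)) =
      expecR L μH β h := by
  have hp := measurePreserving_flip (a := a) (b := b) (L := L) μH hHaar
  have h1 := integral_map (μ := Pm L μH) (φ := flip μ ν a b) hp.measurable.aemeasurable
    (f := fun U => h U * wt L β U) (hh.mul bddMeas_wt).1.aestronglyMeasurable
  rw [hp.map_eq] at h1
  rw [expecR, expecR, h1]
  simp only [wt_flip hμν hL, mul_assoc]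

lemma expecR_mul_Ow (hμν : μ ≠ ν) (hL : 2 ≤ L μ) {g : Config L 2 → ℝ} (hg : BddMeas g) :
    expecR L μH β (fun U => g (flip μ ν a b U) * Ow β μ ν (a - 1) b U) =
      expecR L μH β (fun U => g U * Ow β μ ν a b U) := by
  rw [← expecR_flip hHaar hμν hL (hg.mul bddMeas_Ow)]
  congr 1
  funext U
  linear_combination (-(g (flip μ ν a b U) * Ow β μ ν (a - 1) b U)) *
    Ow_flip (β := β) (a := a) (b := b) hμν hL U

lemma expecR_Fw_sub_one (hμν : μ ≠ ν) (hL : 2 ≤ L μ) :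
    expecR L μH β (Fw β μ ν (a - 1) b) = expecR L μH β (Fw β μ ν a b) := by
  have h := expecR_mul_Ow (β := β) (a := a) (b := b) hHaar hμν hL (bddMeas_const 1)
  simp only [one_mul] at h
  rw [expecR_Fw, expecR_Fw, h]

lemma expecR_Fw_left (hμν : μ ≠ ν) (hL : 2 ≤ L μ) (a a' : ZMod (L μ)) (b : ZMod (L ν)) :
    expecR L μH β (Fw β μ ν a b) = expecR L μH β (Fw β μ ν a' b) := by
  have h : ∀ n : ℕ, expecR L μH β (Fw β μ ν (a - n) b) = expecR L μH β (Fw β μ ν a b) := by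
    intro n
    induction n with
    | zero => simp
    | succ n ih =>
      rw [← ih]
      have := expecR_Fw_sub_one (β := β) (a := a - (n : ZMod (L μ))) (b := b) hHaar hμν hL
      push_cast
      rwa [← sub_sub]
  have h1 := h (a - a').val
  rw [ZMod.natCast_zmod_val, sub_sub_cancel] at h1
  exact h1.symm

lemma expecR_Fw_eq (hμν : μ ≠ ν) (hL : 2 ≤ L μ) (hL' : 2 ≤ L ν) (a a' : ZMod (L μ))
    (b b' : ZMod (L ν)) :
    expecR L μH β (Fw β μ ν a b) = expecR L μH β (Fw β μ ν a' b') := by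
  rw [expecR_Fw_left hHaar hμν hL a a' b]
  have h := expecR_Fw_left (β := β) hHaar hμν.symm hL' b b' a'
  have hc : ∀ b, Fw β μ ν a' b = Fw β ν μ b a' := fun b => funext fun U => Fw_comm U
  rwa [hc, hc]

lemma expecR_Fw_mul_Fw (hμν : μ ≠ ν) (hL : 2 ≤ L μ) {g : Config L 2 → ℝ} (hg : BddMeas g)
    (hgf : ∀ U, g (flip μ ν a b U) = g U) :
    expecR L μH β (fun U => Fw β μ ν a b U * Fw β μ ν (a - 1) b U * g U) =
      expecR L μH β (fun U => Fw β μ ν a b U * g U) := by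
  have h1 := expecR_flip (β := β) (a := a) (b := b) hHaar hμν hL hg
  have h2 := expecR_mul_Ow (β := β) (a := a) (b := b) hHaar hμν hL hg
  simp only [hgf] at h1 h2
  have hO := bddMeas_Ow (β := β) (a := a) (b := b)
  have hO' := bddMeas_Ow (β := β) (a := a - 1) (b := b)
  have e1 : (fun U => Fw β μ ν a b U * Fw β μ ν (a - 1) b U * g U) = fun U => 1 / 4 * ((g U -
      g U * Ow β μ ν a b U) - (g U * Ow β μ ν (a - 1) b U -
        g U * (Ow β μ ν a b U * Ow β μ ν (a - 1) b U))) := by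
    funext U
    rw [Fw, Fw]
    ring
  have e2 : (fun U => Fw β μ ν a b U * g U) = fun U => 1 / 2 * (g U - g U * Ow β μ ν a b U) := by
    funext U
    rw [Fw]
    ring
  rw [e1, e2, expecR_const_mul, expecR_const_mul, expecR_sub (hg.sub (hg.mul hO))
    ((hg.mul hO').sub (hg.mul (hO.mul hO'))), expecR_sub hg (hg.mul hO),
    expecR_sub (hg.mul hO') (hg.mul (hO.mul hO')), h1, h2]
  ring

lemma expecR_mul_Fw_add (hμν : μ ≠ ν) (hL : 2 ≤ L μ) {g : Config L 2 → ℝ} (hg : BddMeas g)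
    (hgf : ∀ U, g (flip μ ν a b U) = - g U) :
    expecR L μH β (fun U => g U * Fw β μ ν a b U) +
      expecR L μH β (fun U => g U * Fw β μ ν (a - 1) b U) = expecR L μH β g := by
  have h2 := expecR_mul_Ow (β := β) (a := a) (b := b) hHaar hμν hL hg
  simp only [hgf, neg_mul] at h2
  rw [expecR_neg] at h2
  have e1 : ∀ a', (fun U => g U * Fw β μ ν a' b U) =
      fun U => 1 / 2 * (g U - g U * Ow β μ ν a' b U) := by
    intro a'
    funext U
    rw [Fw]
    ring
  rw [e1, e1, expecR_const_mul, expecR_const_mul, expecR_sub hg (hg.mul bddMeas_Ow),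
    expecR_sub hg (hg.mul bddMeas_Ow), ← h2]
  ring

end Expectation

/-! ### Wilson loops under reflections -/

section Loops

variable {d : ℕ} {L : Fin d → ℕ} {μ ν : Fin d}

/-- The product of the link variables along three sides of a rectangle. -/
noncomputable def openRect (L : Fin d → ℕ) (U : Config L 2) (x : Site L) (μ ν : Fin d)
    (l l' : ℕ) : SU 2 :=
  pathProd L U x μ l * pathProd L U (x + l • e L μ) ν l' *
    (pathProd L U (x + l' • e L ν) μ l)⁻¹

lemma wl_eq_sum (U : Config L 2) (x : Site L) (l l' : ℕ) :
    wl L U x μ ν l l' =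
      ∑ n, qc (pathProd L U x ν l') n * qc (openRect L U x μ ν l l') n := by
  rw [← chi_mul_inv]
  rfl

lemma measurable_openRect (x : Site L) (l l' : ℕ) :
    Measurable fun U : Config L 2 => openRect L U x μ ν l l' :=
  ((measurable_pathProd _ _ _).mul (measurable_pathProd _ _ _)).mul (measurable_pathProd _ _ _).inv

lemma rs_add_smul_self (x : Site L) {k : ZMod (L μ)} (hx : x μ = k) (l : ℕ) :
    rs μ k (x + l • e L μ) + l • e L μ = x := by
  rw [rs_add_e_self]
  funext i
  by_cases h : i = μ
  · subst h
    rw [rs_apply_self, hx, add_sub_cancel_right]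
  · rw [rs_apply_ne h]

lemma chi_mul_inv_cyclic (p x b y q c : SU 2) :
    chi (x * b * y⁻¹ * (p⁻¹ * c * q⁻¹⁻¹)⁻¹) = chi (p * x * b * (q * y)⁻¹ * c⁻¹) := by
  rw [mul_assoc p, mul_assoc p, mul_assoc p, chi_mul_comm p]
  congr 1
  simp only [mul_inv_rev, inv_inv, mul_assoc]

lemma chi_openRect_mul_theta_inv (hμν : μ ≠ ν) (U : Config L 2) {x : Site L} {k : ZMod (L μ)}
    (hx : x μ = k) (l l' : ℕ) :
    chi (openRect L U x μ ν l l' * (openRect L (theta μ k U) x μ ν l l')⁻¹) =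
      wl L U (rs μ k (x + l • e L μ)) μ ν (l + l) l' := by
  have h1 := rs_add_smul_self x hx l
  have h2 : rs μ k (x + l' • e L ν + l • e L μ) = rs μ k (x + l • e L μ) + l' • e L ν := by
    rw [← rs_add_e hμν.symm, add_right_comm]
  have h3 := pathProd_theta_self (k := k) U x l
  have h4 := pathProd_theta_self (k := k) U (x + l' • e L ν) l
  have h5 := pathProd_theta_ne (k := k) U (x + l • e L μ) hμν.symm l'
  rw [h2] at h4
  generalize rs μ k (x + l • e L μ) = y at h1 h3 h4 h5 ⊢
  have h6 := pathProd_add U y μ l l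
  have h7 := pathProd_add U (y + l' • e L ν) μ l l
  rw [add_right_comm, h1] at h7
  rw [h1] at h6
  have h8 : y + (l + l) • e L μ = x + l • e L μ := by
    rw [add_smul, ← add_assoc, h1]
  rw [wl, rectHol, openRect, openRect, h3, h4, h5, h6, h7, h8]
  exact chi_mul_inv_cyclic _ _ _ _ _ _

lemma wl_wrap (U : Config L 2) (y : Site L) (l' : ℕ) :
    wl L U y μ ν (L μ) l' = ∑ n : Fin 4 × Fin 4, qc (pathProd L U y μ (L μ)) n.1 *
      qc (pathProd L U (y + l' • e L ν) μ (L μ))⁻¹ n.2 * conjCoeff (pathProd L U y ν l') n := by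
  have h : y + L μ • e L μ = y := by
    funext i
    by_cases h : i = μ
    · subst h
      simp
    · simp [e_apply_ne h]
  rw [← chi_mul_conj, wl, rectHol, h]

variable {k : ZMod (L μ)} {M : ℕ}

lemma dependsOn_pathProd_planeL (hμν : μ ≠ ν) {x : Site L}
    (hx : ht μ k x = 0 ∨ ht μ k x = M) (l : ℕ) :
    DependsOn (fun U : Config L 2 => pathProd L U x ν l) (planeL μ k M) :=
  dependsOn_pathProd fun j _ => by rwa [mem_planeL hμν.symm, ht_add_e_ne hμν.symm]

variable [∀ i, NeZero (L i)]

lemma dependsOn_openRect (hμν : μ ≠ ν) (hM : L μ = 2 * M) {x : Site L} (hx : x μ = k) {l : ℕ}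
    (hl : l ≤ M) (l' : ℕ) :
    DependsOn (fun U : Config L 2 => openRect L U x μ ν l l') (sideL μ k M) := by
  have hM0 : 0 < L μ := Nat.pos_of_neZero _
  have h0 : ht μ k x = 0 := ht_eq_zero hx
  have h1 : ∀ n ≤ M, ht μ k (x + n • e L μ) = n := fun n hn => by
    rw [ht_add_smul_self _ _ (by omega), h0, zero_add]
  intro U V h
  refine congrArg₂ (· * ·) (congrArg₂ (· * ·) ?_ ?_) (congrArg _ ?_)
  · refine dependsOn_pathProd (fun j hj => ?_) h
    rw [mem_sideL_self, h1 j (by omega)]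
    omega
  · refine dependsOn_pathProd (fun j hj => ?_) h
    rw [mem_sideL_ne hμν.symm, ht_add_e_ne hμν.symm, h1 l hl]
    exact hl
  · refine dependsOn_pathProd (fun j hj => ?_) h
    rw [mem_sideL_self, add_right_comm, ht_add_e_ne hμν.symm, h1 j (by omega)]
    omega

variable {β : ℝ} {μH : Measure (SU 2)} [IsProbabilityMeasure μH]
  (hHaar : ∀ g : SU 2, Measure.map (fun u => g * u) μH = μH)

include hHaar

/-- Reflecting a Wilson loop with one side in a reflection hyperplane. -/
lemma expecR_wl_mul_sq_le (hμν : μ ≠ ν) (hM : L μ = 2 * M) {x : Site L} (hx : x μ = k) {l : ℕ}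
    (hl : l ≤ M) (l' : ℕ) {f : Config L 2 → ℝ} (hf : BddMeas f)
    (hfΛ : DependsOn f (sideL μ k M)) :
    expecR L μH β (fun U => wl L U x μ ν l l' * f U) ^ 2 ≤
      expecR L μH β fun U => wl L U (rs μ k (x + l • e L μ)) μ ν (l + l) l' *
        (f U * f (theta μ k U)) := by
  have h := expecR_cauchySchwarz (β := β) hHaar hM k
    (a := fun n U => qc (pathProd L U x ν l') n)
    (f := fun n U => qc (openRect L U x μ ν l l') n * f U) (g := fun _ => 1)
    (fun n => (bddMeas_qc n).comp (measurable_pathProd _ _ _))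
    (fun n U V h => congrArg (qc · n)
      (dependsOn_pathProd_planeL hμν (Or.inl (ht_eq_zero hx)) l' h))
    (fun U => (sum_qc_sq _).le)
    (fun n => ((bddMeas_qc n).comp (measurable_openRect _ _ _)).mul hf)
    (fun n U V h => congrArg₂ (· * ·)
      (congrArg (qc · n) (dependsOn_openRect hμν hM hx hl l' h)) (hfΛ h))
    (bddMeas_const 1) (fun _ _ _ => rfl)
  simp only [mul_one, expecR_one] at h
  convert h using 3 with U U
  · funext U
    rw [wl_eq_sum, Finset.sum_mul]
    exact Finset.sum_congr rfl fun n _ => mul_assoc _ _ _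
  · rw [← chi_openRect_mul_theta_inv hμν U hx, chi_mul_inv, Finset.sum_mul]
    refine Finset.sum_congr rfl fun n _ => ?_
    ring

lemma expecR_wl_sq_le (hμν : μ ≠ ν) (hM : L μ = 2 * M) (x : Site L) {l : ℕ} (hl : l ≤ M)
    (l' : ℕ) : ∃ y, expecR L μH β (fun U => wl L U x μ ν l l') ^ 2 ≤
      expecR L μH β fun U => wl L U y μ ν (2 * l) l' := by
  have h := expecR_wl_mul_sq_le (β := β) hHaar hμν hM (rfl : x μ = x μ) hl l' (bddMeas_const 1)
    fun _ _ _ => rfl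
  simp only [mul_one, ← two_mul] at h
  exact ⟨_, h⟩

end Loops

/-! ### The loop of half the lattice size -/

lemma le_two_mul_rpow {w r s F : ℝ} (hw : w = r + s) (hw1 : w ≤ 1) (hr : (r ^ 2) ^ 2 ≤ 4 * F)
    (hs : s ^ 2 ≤ F) (hF : 0 ≤ F) : w ≤ 2 * F ^ ((1 / 2 : ℝ) ^ 2) := by
  set t := F ^ ((1 / 2 : ℝ) ^ 2) with ht
  have ht0 : 0 ≤ t := Real.rpow_nonneg hF _
  have htF : t ^ 4 = F := by
    rw [ht, ← Real.rpow_natCast, ← Real.rpow_mul hF]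
    norm_num
  rw [← htF] at hr hs
  rcases le_total (1 / 2) t with h | h
  · linarith
  have hs' : s ≤ t ^ 2 := by
    refine le_of_abs_le <| abs_le_of_sq_le_sq ?_ (sq_nonneg t)
    nlinarith
  have hr' : r ≤ 3 / 2 * t := by
    have h1 : r ^ 2 ≤ 2 * t ^ 2 := by
      refine le_of_abs_le <| abs_le_of_sq_le_sq ?_ (by positivity)
      nlinarith
    refine le_of_abs_le <| abs_le_of_sq_le_sq ?_ (by positivity)
    nlinarith
  nlinarith

lemma le_two_mul_rpow_of_sq_le {w w' F : ℝ} {n : ℕ} (hF : 0 ≤ F) (h : w ^ 2 ≤ w')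
    (hw' : w' ≤ 2 * F ^ ((1 / 2 : ℝ) ^ n)) : w ≤ 2 * F ^ ((1 / 2 : ℝ) ^ (n + 1)) := by
  set t := F ^ ((1 / 2 : ℝ) ^ (n + 1)) with ht
  have ht0 : 0 ≤ t := Real.rpow_nonneg hF _
  have htF : F ^ ((1 / 2 : ℝ) ^ n) = t ^ 2 := by
    rw [ht, ← Real.rpow_natCast (F ^ _), ← Real.rpow_mul hF, pow_succ]
    congr 1
    push_cast
    ring
  rw [htF] at hw'
  refine le_of_abs_le <| abs_le_of_sq_le_sq ?_ (by positivity)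
  nlinarith

section HalfSize

variable {d : ℕ} {L : Fin d → ℕ} {μ ν : Fin d} {β : ℝ} {M M' : ℕ}
  {k : ZMod (L μ)} {k' : ZMod (L ν)} {a : ZMod (L μ)} {b : ZMod (L ν)}

lemma wl_flip (hμν : μ ≠ ν) (U : Config L 2) (x : Site L) {l l' : ℕ} (hl : 0 < l) (hl2 : l < L μ)
    (hl' : 0 < l') (hl2' : l' < L ν) :
    wl L (flip μ ν (x μ) (x ν) U) x μ ν l l' = - wl L U x μ ν l l' := by
  have h : (x + l • e L μ) μ ≠ x μ := by
    rw [Ne, Pi.add_apply, add_eq_left, Pi.smul_apply, e_apply_self, nsmul_eq_mul, mul_one,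
      ZMod.natCast_eq_zero_iff]
    exact Nat.not_dvd_of_pos_of_lt hl hl2
  rw [wl, wl, ← chi_negOne_mul, rectHol, rectHol, pathProd_flip_of_ne hμν, pathProd_flip_of_ne hμν,
    pathProd_flip_of_coord_ne hμν _ h, pathProd_flip_self _ rfl rfl hl' hl2', mul_inv_rev,
    negOne_inv, negOne_mul_comm, mul_assoc _ _ negOne]

variable [∀ i, NeZero (L i)]

lemma Fw_theta_self (hμν : μ ≠ ν) (U : Config L 2) :
    Fw β μ ν k b (theta μ k U) = Fw β μ ν (k - 1) b U := by
  rw [Fw_theta hμν, add_sub_cancel_right]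

lemma Fw_theta_right (hμν : μ ≠ ν) (U : Config L 2) :
    Fw β μ ν a k' (theta ν k' U) = Fw β μ ν a (k' - 1) U := by
  rw [Fw_comm, Fw_theta_self hμν.symm, Fw_comm]

lemma dependsOn_Fw_self (hμν : μ ≠ ν) (hM : L μ = 2 * M) :
    DependsOn (Fw β μ ν k b : Config L 2 → ℝ) (sideL μ k M) := by
  have hM0 : 0 < L μ := Nat.pos_of_neZero _
  refine dependsOn_Fw hμν hM ?_
  rw [sub_self, ZMod.val_zero]
  omega

lemma dependsOn_Fw_right (hμν : μ ≠ ν) (hM' : L ν = 2 * M') :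
    DependsOn (Fw β μ ν a k' : Config L 2 → ℝ) (sideL ν k' M') := by
  intro U V h
  rw [Fw_comm, Fw_comm V]
  exact dependsOn_Fw_self hμν.symm hM' h

lemma sub_one_ne_self {n : ℕ} (hn : 2 ≤ n) (c : ZMod n) : c - 1 ≠ c := by
  have : Fact (1 < n) := ⟨hn⟩
  rw [Ne, sub_eq_self]
  exact one_ne_zero

variable {μH : Measure (SU 2)} [IsProbabilityMeasure μH]
  (hHaar : ∀ g : SU 2, Measure.map (fun u => g * u) μH = μH)

include hHaar

lemma expecR_Fw_pair (hμν : μ ≠ ν) (hL : 2 ≤ L μ) :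
    expecR L μH β (fun U => Fw β μ ν a b U * Fw β μ ν (a - 1) b U) =
      expecR L μH β (Fw β μ ν a b) := by
  have h := expecR_Fw_mul_Fw (β := β) (a := a) (b := b) hHaar hμν hL (bddMeas_const 1)
    fun _ => rfl
  simpa only [mul_one] using h

lemma expecR_Fw_quad (hμν : μ ≠ ν) (hL : 2 ≤ L μ) (hL' : 2 ≤ L ν) :
    expecR L μH β (fun U => Fw β μ ν a b U * Fw β μ ν (a - 1) b U *
      (Fw β μ ν a (b - 1) U * Fw β μ ν (a - 1) (b - 1) U)) = expecR L μH β (Fw β μ ν a b) := by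
  have hb := sub_one_ne_self hL' b
  rw [expecR_Fw_mul_Fw hHaar hμν hL (bddMeas_Fw.mul bddMeas_Fw)
    fun U => by rw [Fw_flip_of_ne hμν hL hb, Fw_flip_of_ne hμν hL hb]]
  have h1 := expecR_Fw_mul_Fw (β := β) (a := a) (b := b - 1) hHaar hμν hL
    (bddMeas_Fw (β := β) (a := a) (b := b)) fun U => Fw_flip_of_ne hμν hL hb.symm U
  have h2 := expecR_Fw_pair (β := β) (a := b) (b := a) hHaar hμν.symm hL'
  have h3 : ∀ b, Fw β ν μ b a = Fw β μ ν a b := fun b => funext fun U => Fw_comm U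
  simp only [h3] at h2
  simp only [mul_comm] at h1 h2 ⊢
  rw [h1, h2]

lemma expecR_Fw_nonneg (hμν : μ ≠ ν) (hM : L μ = 2 * M) :
    0 ≤ expecR L μH β (Fw β μ ν a b) := by
  have hM0 : 0 < L μ := Nat.pos_of_neZero _
  rw [← expecR_Fw_pair hHaar hμν (by omega)]
  have h := expecR_reflect_nonneg (β := β) hHaar hM a bddMeas_Fw
    (dependsOn_Fw_self (β := β) (b := b) hμν hM)
  simpa only [Fw_theta_self hμν] using h

lemma expecR_wl_eq_add (hμν : μ ≠ ν) (hM : L μ = 2 * M) (hM' : L ν = 2 * M') (x : Site L) :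
    expecR L μH β (fun U => wl L U x μ ν M M') =
      expecR L μH β (fun U => wl L U x μ ν M M' * Fw β μ ν (x μ) (x ν) U) +
        expecR L μH β (fun U => wl L U x μ ν M M' * Fw β μ ν (x μ - 1) (x ν) U) := by
  have hM0 : 0 < L μ := Nat.pos_of_neZero _
  have hM0' : 0 < L ν := Nat.pos_of_neZero _
  rw [expecR_mul_Fw_add hHaar hμν (by omega) (bddMeas_wl x μ ν M M') fun U =>
    wl_flip hμν U x (by omega) (by omega) (by omega) (by omega)]

lemma expecR_wl_mul_Fw_sub_one_sq_le (hμν : μ ≠ ν) (hM : L μ = 2 * M) (x : Site L) :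
    expecR L μH β (fun U => wl L U x μ ν M M' * Fw β μ ν (x μ - 1) b U) ^ 2 ≤
      expecR L μH β (Fw β μ ν (x μ) b) := by
  have hM0 : 0 < L μ := Nat.pos_of_neZero _
  have hW : BddMeas fun U : Config L 2 => wl L U x μ ν M M' := bddMeas_wl x μ ν M M'
  have h := expecR_cauchySchwarz (β := β) hHaar hM (x μ) (κ := Unit) (a := fun _ _ => 1)
    (f := fun _ U => wl L U x μ ν M M') (g := Fw β μ ν (x μ) b) (fun _ => bddMeas_const 1)
    (fun _ _ _ _ => rfl) (fun _ => by simp) (fun _ => hW)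
    (fun _ U V h => congrArg chi (congrArg₂ (· * ·)
      (dependsOn_openRect hμν hM rfl le_rfl M' h)
      (congrArg (·⁻¹) (dependsOn_pathProd (fun j _ => by
        rw [mem_sideL_ne hμν.symm, ht_add_e_ne hμν.symm, ht_eq_zero rfl]
        exact Nat.zero_le _) h)))) bddMeas_Fw (dependsOn_Fw_self hμν hM)
  simp only [Finset.univ_unique, Finset.sum_singleton, one_mul, Fw_theta_self hμν] at h
  refine h.trans ?_
  rw [expecR_Fw_pair hHaar hμν (by omega)]
  refine mul_le_of_le_one_left (expecR_Fw_nonneg hHaar hμν hM) ?_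
  refine expecR_le_one (hW.mul (bddMeas_theta hHaar hW _)) fun U => ?_
  refine (le_abs_self _).trans ?_
  rw [abs_mul]
  exact mul_le_one₀ (abs_chi_le _) (abs_nonneg _) (abs_chi_le _)

/-- The expectation of a loop that winds around the lattice in one direction. -/
lemma expecR_wrap_sq_le (hμν : μ ≠ ν) (hM : L μ = 2 * M) (hM' : L ν = 2 * M') (y : Site L)
    (hy : ht μ k y = M) :
    expecR L μH β (fun U => wl L U y μ ν (L μ) M' *
      (Fw β μ ν k (y ν) U * Fw β μ ν (k - 1) (y ν) U)) ^ 2 ≤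
      4 * expecR L μH β (Fw β μ ν k (y ν)) := by
  have hM0 : 0 < L μ := Nat.pos_of_neZero _
  have hM0' : 0 < L ν := Nat.pos_of_neZero _
  have hy0 : ht ν (y ν) y = 0 := ht_eq_zero rfl
  have hp : ∀ i, ∀ z : Site L, ht ν (y ν) z = 0 ∨ ht ν (y ν) z = M' →
      DependsOn (fun U : Config L 2 => pathProd L U z μ i) (planeL ν (y ν) M') := fun i z hz =>
    dependsOn_pathProd_planeL hμν.symm hz i
  have h1 := expecR_cauchySchwarz (β := β) hHaar hM' (y ν)
    (a := fun (n : Fin 4 × Fin 4) U => qc (pathProd L U y μ (L μ)) n.1 *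
      qc (pathProd L U (y + M' • e L ν) μ (L μ))⁻¹ n.2)
    (f := fun n U => conjCoeff (pathProd L U y ν M') n *
      (Fw β μ ν k (y ν) U * Fw β μ ν (k - 1) (y ν) U)) (g := fun _ => 1)
    (fun n => ((bddMeas_qc _).comp (measurable_pathProd _ _ _)).mul
      ((bddMeas_qc _).comp (measurable_pathProd _ _ _).inv))
    (fun n U V h => congrArg₂ (· * ·)
      (congrArg (qc · n.1) (hp _ _ (Or.inl hy0) h))
      (congrArg (fun g => qc g⁻¹ n.2) (hp _ _ (Or.inr (by
        rw [ht_add_smul_self _ _ (by omega), hy0, zero_add])) h)))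
    (fun U => by
      simp only [mul_pow, Fintype.sum_prod_type, ← Finset.mul_sum, sum_qc_sq, mul_one, le_refl])
    (fun n => ((bddMeas_conjCoeff n).comp (measurable_pathProd _ _ _)).mul
      (bddMeas_Fw.mul bddMeas_Fw))
    (fun n U V h => congrArg₂ (· * ·)
      (congrArg (conjCoeff · n) (dependsOn_pathProd (fun j hj => by
        rw [mem_sideL_self, ht_add_smul_self _ _ (by omega), hy0]
        omega) h))
      (congrArg₂ (· * ·) (dependsOn_Fw_right hμν hM' h) (dependsOn_Fw_right hμν hM' h)))
    (bddMeas_const 1) (fun _ _ _ => rfl)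
  simp only [mul_one, expecR_one] at h1
  have e1 : (fun U => wl L U y μ ν (L μ) M' *
      (Fw β μ ν k (y ν) U * Fw β μ ν (k - 1) (y ν) U)) = fun U => ∑ n : Fin 4 × Fin 4,
      qc (pathProd L U y μ (L μ)) n.1 * qc (pathProd L U (y + M' • e L ν) μ (L μ))⁻¹ n.2 *
        (conjCoeff (pathProd L U y ν M') n *
          (Fw β μ ν k (y ν) U * Fw β μ ν (k - 1) (y ν) U)) := by
    funext U
    rw [wl_wrap, Finset.sum_mul]
    exact Finset.sum_congr rfl fun n _ => mul_assoc _ _ _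
  rw [e1]
  refine h1.trans ?_
  have h2 := expecR_mul_reflect_le (β := β) hHaar hM k
    (a := fun U => chi (pathProd L U y ν M' *
      (pathProd L (theta ν (y ν) U) y ν M')⁻¹) ^ 2)
    (f := fun U => Fw β μ ν k (y ν) U * Fw β μ ν k (y ν - 1) U)
    ?_ ?_ (fun U => (sq_le_one_iff_abs_le_one _).2 (abs_chi_le _)) (bddMeas_Fw.mul bddMeas_Fw)
    (fun U V h => congrArg₂ (· * ·) (dependsOn_Fw_self hμν hM h) (dependsOn_Fw_self hμν hM h))
  · rw [← expecR_Fw_quad hHaar hμν (by omega) (by omega)]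
    simp only [Fw_theta_self hμν] at h2
    convert mul_le_mul_of_nonneg_left h2 zero_le_four using 1
    · rw [← expecR_const_mul]
      congr 1
      funext U
      simp only [Fw_theta_right hμν]
      rw [← mul_assoc 4, ← sum_conjCoeff_mul, Finset.sum_mul]
      refine Finset.sum_congr rfl fun n _ => ?_
      ring
    · congr 2
      funext U
      ring
  · exact ((bddMeas_chi.comp ((measurable_pathProd _ _ _).mul ((measurable_pathProd _ _ _).comp
      (measurePreserving_theta μH hHaar).measurable).inv))).pow 2
  · intro U V h
    have hz : ∀ z : Site L, ht μ k z = M →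
        DependsOn (fun U : Config L 2 => pathProd L U z ν M') (planeL μ k M) := fun z hz =>
      dependsOn_pathProd_planeL hμν (Or.inr hz) M'
    simp only [pathProd_theta_self]
    refine congrArg (fun g => chi g ^ 2) (congrArg₂ (· * ·) (hz _ hy h)
      (congrArg (fun g => g⁻¹⁻¹) (hz _ ?_ h)))
    rw [ht, rs_apply_ne hμν]
    simpa [e_apply_ne hμν, ht] using hy

lemma expecR_wl_mul_Fw_pow_le (hμν : μ ≠ ν) (hM : L μ = 2 * M) (hM' : L ν = 2 * M')
    (x : Site L) :
    (expecR L μH β (fun U => wl L U x μ ν M M' * Fw β μ ν (x μ) (x ν) U) ^ 2) ^ 2 ≤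
      4 * expecR L μH β (Fw β μ ν (x μ) (x ν)) := by
  have hM0 : 0 < L μ := Nat.pos_of_neZero _
  have h := expecR_wl_mul_sq_le (β := β) hHaar hμν hM rfl le_rfl M'
    (bddMeas_Fw (β := β) (b := x ν)) (dependsOn_Fw_self (k := x μ) hμν hM)
  simp only [Fw_theta_self hμν, ← two_mul, ← hM] at h
  refine (pow_le_pow_left₀ (sq_nonneg _) h 2).trans ?_
  have hν : rs μ (x μ) (x + M • e L μ) ν = x ν := by
    rw [rs_apply_ne hμν.symm]
    simp [e_apply_ne hμν.symm]
  have hy : ht μ (x μ) (rs μ (x μ) (x + M • e L μ)) = M := by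
    have h0 : ht μ (x μ) (x + M • e L μ) = M := by
      rw [ht_add_smul_self, ht_eq_zero rfl, zero_add]
      rw [ht_eq_zero rfl]
      omega
    rw [rs_eq_self hM (Or.inr h0), h0]
  have h2 := expecR_wrap_sq_le (β := β) hHaar hμν hM hM' _ hy
  rwa [hν] at h2

lemma expecR_wl_half_le (hμν : μ ≠ ν) (hM : L μ = 2 * M) (hM' : L ν = 2 * M') (x : Site L) :
    expecR L μH β (fun U => wl L U x μ ν M M') ≤
      2 * expecR L μH β (Fw β μ ν a b) ^ ((1 / 2 : ℝ) ^ 2) := by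
  have hM0 : 0 < L μ := Nat.pos_of_neZero _
  have hM0' : 0 < L ν := Nat.pos_of_neZero _
  rw [expecR_Fw_eq hHaar hμν (by omega) (by omega) a (x μ) b (x ν)]
  exact le_two_mul_rpow (expecR_wl_eq_add hHaar hμν hM hM' x)
    (expecR_le_one (bddMeas_wl x μ ν M M') fun U => (le_abs_self _).trans (abs_chi_le _))
    (expecR_wl_mul_Fw_pow_le hHaar hμν hM hM' x)
    (expecR_wl_mul_Fw_sub_one_sq_le hHaar hμν hM x) (expecR_Fw_nonneg hHaar hμν hM)

lemma expecR_wl_le_left (hμν : μ ≠ ν) (hM' : L ν = 2 * M') {p : ℕ} (hp : 1 ≤ p) :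
    ∀ (l : ℕ), L μ = 2 ^ p * l → ∀ x : Site L,
    expecR L μH β (fun U => wl L U x μ ν l M') ≤
      2 * expecR L μH β (Fw β μ ν a b) ^ ((1 / 2 : ℝ) ^ (p + 1)) := by
  induction p, hp using Nat.le_induction with
  | base =>
    intro l hl x
    exact expecR_wl_half_le hHaar hμν (by rwa [pow_one] at hl) hM' x
  | succ p hp ih =>
    intro l hl x
    have hl' : L μ = 2 * (2 ^ p * l) := by rw [hl, pow_succ']; ring
    obtain ⟨y, hy⟩ := expecR_wl_sq_le (β := β) hHaar hμν hl' x
      (Nat.le_mul_of_pos_left l (by positivity)) M'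
    exact le_two_mul_rpow_of_sq_le (expecR_Fw_nonneg hHaar hμν hl') hy
      (ih (2 * l) (by rw [hl']; ring) y)

lemma expecR_wl_le (hμν : μ ≠ ν) {p q : ℕ} (hp : 1 ≤ p) (hq : 1 ≤ q) {l : ℕ}
    (hl : L μ = 2 ^ p * l) : ∀ (l' : ℕ), L ν = 2 ^ q * l' → ∀ x : Site L,
    expecR L μH β (fun U => wl L U x μ ν l l') ≤
      2 * expecR L μH β (Fw β μ ν a b) ^ ((1 / 2 : ℝ) ^ (p + q)) := by
  induction q, hq using Nat.le_induction with
  | base =>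
    intro l' hl' x
    exact expecR_wl_le_left hHaar hμν (by rwa [pow_one] at hl') hp l hl x
  | succ q hq ih =>
    intro l' hl' x
    have h2 : L ν = 2 * (2 ^ q * l') := by rw [hl', pow_succ']; ring
    have h3 : L μ = 2 * (2 ^ (p - 1) * l) := by
      rw [hl, ← mul_assoc, mul_pow_sub_one (by omega)]
    obtain ⟨y, hy⟩ := expecR_wl_sq_le (β := β) hHaar hμν.symm h2 x
      (Nat.le_mul_of_pos_left l' (by positivity)) l
    simp only [← wl_comm] at hy
    exact le_two_mul_rpow_of_sq_le (expecR_Fw_nonneg hHaar hμν h3) hy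
      (ih (2 * l') (by rw [h2]; ring) y)

end HalfSize
/-- **Tomboulis–Yaffe inequality for SU(2) lattice gauge theory.**
On the periodic `d`-dimensional lattice (`d ≥ 3`) with the SU(2) Wilson action at
coupling `β > 0`, for a vortex `V` (directions `μ < ν`, coordinates `c1, c2`) and a
rectangular loop `C` of sides `lμ, lν` in a `μ`-`ν` plane with `L μ = 2^p lμ`,
`L ν = 2^q lν`, the fundamental Wilson loop `W(C) = (1/2) Tr ∏_{b∈C} U_b` satisfies
`⟨W(C)⟩ ≤ 2 ((1/2)(1 − Z_Λ^(−)/Z_Λ))^{A_C/(L_μ L_ν)}`, where `Z_Λ^(−) = Ztw … 1`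
is the partition function twisted by `−1 = z^1 ∈ Z₂` on the vortex `V`. -/
theorem tomboulis_yaffe_su2
    {d : ℕ} (hd : 3 ≤ d) (L : Fin d → ℕ) [∀ i, NeZero (L i)]
    (β : ℝ) (hβ : 0 < β)
    (μH : Measure (SU 2)) [IsProbabilityMeasure μH]
    (hHaar : ∀ g : SU 2, Measure.map (fun u => g * u) μH = μH)
    (μ ν : Fin d) (hμν : μ < ν)
    (c1 : ZMod (L μ)) (c2 : ZMod (L ν))
    (x0 : Site L) (lμ lν p q : ℕ) (hp : 0 < p) (hq : 0 < q)
    (hLμ : L μ = 2 ^ p * lμ) (hLν : L ν = 2 ^ q * lν) :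
    (expecC L μH β fun U =>
        (2 : ℂ)⁻¹ * (toM (rectHol L U x0 μ ν lμ lν)).trace).re ≤
      2 * ((2 : ℝ)⁻¹ * (1 - Ztw L μH β c1 c2 1 / Zpart L μH β)) ^
        ((lμ * lν : ℝ) / ((L μ : ℝ) * (L ν : ℝ))) := by
  have hF : (2 : ℝ)⁻¹ * (1 - Ztw L μH β c1 c2 1 / Zpart L μH β) =
      expecR L μH β (Fw β μ ν c1 c2) := by
    have h : Ztw L μH β c1 c2 1 / Zpart L μH β = expecR L μH β (Ow β μ ν c1 c2) := by
      simp only [Ztw, expecR, Ovort_eq]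
    rw [h, expecR_Fw]
    ring
  have hW : (expecC L μH β fun U =>
      (2 : ℂ)⁻¹ * (toM (rectHol L U x0 μ ν lμ lν)).trace).re =
      expecR L μH β fun U => wl L U x0 μ ν lμ lν := by
    have h : ∀ U : Config L 2, (2 : ℂ)⁻¹ * (toM (rectHol L U x0 μ ν lμ lν)).trace *
        (wt L β U : ℂ) = ((wl L U x0 μ ν lμ lν * wt L β U : ℝ) : ℂ) := fun U => by
      rw [trace_toM_eq, wl]
      push_cast
      ring
    simp only [expecC, h]
    rw [integral_complex_ofReal, ← Complex.ofReal_div, Complex.ofReal_re, expecR]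
  have he : (lμ * lν : ℝ) / ((L μ : ℝ) * (L ν : ℝ)) = (1 / 2) ^ (p + q) := by
    have h1 : (L μ : ℝ) ≠ 0 := Nat.cast_ne_zero.2 (NeZero.ne _)
    have h2 : (L ν : ℝ) ≠ 0 := Nat.cast_ne_zero.2 (NeZero.ne _)
    rw [div_eq_iff (mul_ne_zero h1 h2), hLμ, hLν]
    push_cast
    rw [one_div, inv_pow, pow_add]
    field_simp
  rw [hF, hW, he]
  exact expecR_wl_le hHaar hμν.ne hp hq hLμ lν hLν x0

end TYLGT
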